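/- Let μ be a complex number and n a positive odd integer. Then b_n(0,1,μ) = det_{1≤i,j≤n}( −δ_{i−1,j} + C(μ+i+j−3, j) ) equals (μ−1) · ∏_{k=1}^{(n−1)/2} Q1(k) Q2(k), where Q1(k) = 2 (μ/2+2k)_{k+1} (μ+2k−1)_{k+1} / ( (k+2)_{k+1} (μ/2+k)_{k+1} ) and Q2(k) = (μ+2k−2) (μ/2+2k−1)_{k−1} (μ+2k+1)_{k−1} / ( k (k)_{k−1} (μ/2+k+1)_{k−1} ); the identity is understood after clearing all denominators (equivalently, it holds whenever all denominators are nonzero). -/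

import Mathlib

/-- Generalized binomial coefficient `C(x,k) = x(x-1)⋯(x-k+1)/k!` for complex `x`. -/
noncomputable def gbinom (x : ℂ) (k : ℕ) : ℂ :=
  (∏ i ∈ Finset.range k, (x - i)) / (k.factorial : ℂ)

/-- Pochhammer symbol `(x)_k = x(x+1)⋯(x+k-1)`. -/
noncomputable def poch (x : ℂ) (k : ℕ) : ℂ :=
  ∏ i ∈ Finset.range k, (x + i)
/-- `b_n(I,J,μ)`: determinant of the `n×n` matrix with rows indexed by
`i = I,…,n-1+I`, columns indexed by `j = J,…,n-1+J`, and entries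
`-δ_{i,j} + C(μ+i+j-2, j)`. -/
noncomputable def bdet (μ : ℂ) (n I J : ℕ) : ℂ :=
  Matrix.det (Matrix.of fun i j : Fin n =>
    (if I + i.1 = J + j.1 then (-1 : ℂ) else 0)
      + gbinom (μ + ((I + i.1 : ℕ) : ℂ) + ((J + j.1 : ℕ) : ℂ) - 2) (J + j.1))
noncomputable def Q1 (μ : ℂ) (k : ℕ) : ℂ :=
  2 * poch (μ / 2 + 2 * k) (k + 1) * poch (μ + 2 * k - 1) (k + 1)
    / (poch ((k : ℂ) + 2) (k + 1) * poch (μ / 2 + k) (k + 1))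

noncomputable def Q2 (μ : ℂ) (k : ℕ) : ℂ :=
  (μ + 2 * k - 2) * poch (μ / 2 + 2 * k - 1) (k - 1) * poch (μ + 2 * k + 1) (k - 1)
    / ((k : ℂ) * poch (k : ℂ) (k - 1) * poch (μ / 2 + k + 1) (k - 1))

open PowerSeries in
/-- The power series `(1 - X) ^ β`. -/
noncomputable def oneSubPow (β : ℂ) : PowerSeries ℂ :=
  rescale (-1) (binomialSeries ℂ β)

@[simp]
lemma gbinom_zero (x : ℂ) : gbinom x 0 = 1 := by simp [gbinom]

lemma gbinom_succ (x : ℂ) (k : ℕ) : ((k : ℂ) + 1) * gbinom x (k + 1) = (x - k) * gbinom x k := by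
  have h1 : ((k : ℂ) + 1) ≠ 0 := by exact_mod_cast Nat.succ_ne_zero k
  have h2 : (k.factorial : ℂ) ≠ 0 := by exact_mod_cast Nat.factorial_ne_zero k
  simp only [gbinom, Finset.prod_range_succ, Nat.factorial_succ, Nat.cast_mul, Nat.cast_succ]
  field_simp

lemma choose_eq_gbinom (x : ℂ) (k : ℕ) : Ring.choose x k = gbinom x k := by
  have h : ∀ k : ℕ, (descPochhammer ℤ k).smeval x = ∏ i ∈ Finset.range k, (x - i) := by
    intro k
    induction k with
    | zero => simp
    | succ k ih =>
      simp [descPochhammer_succ_right, Polynomial.smeval_mul, Polynomial.smeval_natCast, ih,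
        Finset.prod_range_succ]
  rw [Ring.choose_eq_smul, h, gbinom, smul_eq_mul, div_eq_inv_mul]

lemma gbinom_pascal (x : ℂ) (k : ℕ) :
    gbinom (x + 1) (k + 1) = gbinom x (k + 1) + gbinom x k := by
  rw [← choose_eq_gbinom, Ring.choose_succ_succ, choose_eq_gbinom, choose_eq_gbinom, add_comm]

lemma gbinom_reflect (x : ℂ) (k : ℕ) : gbinom (k - 1 - x) k = (-1) ^ k * gbinom x k := by
  have h : ∏ i ∈ Finset.range k, ((k : ℂ) - 1 - x - i)
      = (-1) ^ k * ∏ i ∈ Finset.range k, (x - i) := by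
    rw [← Finset.prod_range_reflect, ← Finset.card_range k, ← Finset.prod_const,
      Finset.card_range, ← Finset.prod_mul_distrib]
    refine Finset.prod_congr rfl fun i hi => ?_
    have := Finset.mem_range.1 hi
    rw [show k - 1 - i = k - (1 + i) by omega, Nat.cast_sub (by omega)]
    push_cast
    ring
  rw [gbinom, h, gbinom, mul_div_assoc]

lemma coeff_oneSubPow (β : ℂ) (n : ℕ) :
    PowerSeries.coeff n (oneSubPow β) = (-1) ^ n * gbinom β n := by
  simp [oneSubPow, PowerSeries.coeff_rescale, choose_eq_gbinom]

lemma oneSubPow_add (β γ : ℂ) : oneSubPow (β + γ) = oneSubPow β * oneSubPow γ := by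
  simp [oneSubPow]

lemma oneSubPow_nat (k : ℕ) : oneSubPow (k : ℂ) = (1 - PowerSeries.X) ^ k := by
  simp [oneSubPow, PowerSeries.rescale_X, sub_eq_add_neg]

lemma oneSubPow_nsmul (β : ℂ) (k : ℕ) : oneSubPow (k * β) = oneSubPow β ^ k := by
  induction k with
  | zero => simpa using oneSubPow_nat 0
  | succ k ih => rw [pow_succ, ← ih, ← oneSubPow_add]; congr 1; push_cast; ring

lemma coeff_oneSubPow_reflect (β : ℂ) (n : ℕ) :
    PowerSeries.coeff n (oneSubPow (n - 1 - β)) = (-1) ^ n * PowerSeries.coeff n (oneSubPow β) := by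
  rw [coeff_oneSubPow, coeff_oneSubPow, gbinom_reflect]

/-- The linear map sending `z ^ i` to the series `y ^ i - (1 - y) ^ (-(2a+1) - i)`, whose
coefficients are, up to sign, the rows of the matrix in `bdet (2 * a + 2) n 0 1`. -/
noncomputable def rowMap (a : ℂ) : Polynomial ℂ →ₗ[ℂ] PowerSeries ℂ :=
  (Polynomial.aeval (PowerSeries.X : PowerSeries ℂ)).toLinearMap -
    LinearMap.mulLeft ℂ (oneSubPow (-(2 * a + 1))) ∘ₗ
      (Polynomial.aeval (oneSubPow (-1))).toLinearMap

lemma rowMap_apply (a : ℂ) (p : Polynomial ℂ) :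
    rowMap a p = Polynomial.aeval (PowerSeries.X : PowerSeries ℂ) p -
      oneSubPow (-(2 * a + 1)) * Polynomial.aeval (oneSubPow (-1)) p := rfl

lemma oneSubPow_neg_one_mul : oneSubPow (-1) * (1 - PowerSeries.X) = 1 := by
  have h := oneSubPow_add (-1) ((1 : ℕ) : ℂ)
  rw [oneSubPow_nat, pow_one] at h
  rw [← h]
  simpa using oneSubPow_nat 0

lemma oneSubPow_neg_one_mul_sub_one :
    oneSubPow (-1) * (oneSubPow (-1) - 1) = PowerSeries.X * oneSubPow (-2) := by
  have h : oneSubPow (-2) = oneSubPow (-1) * oneSubPow (-1) := by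
    rw [← oneSubPow_add]; norm_num
  rw [h]
  linear_combination oneSubPow (-1) * oneSubPow_neg_one_mul

lemma rowMap_pow (a : ℂ) (k : ℕ) :
    rowMap a ((Polynomial.X * (Polynomial.X - 1)) ^ k) =
      PowerSeries.X ^ k * ((-1) ^ k * oneSubPow k - oneSubPow (-2 * a - 1 - 2 * k)) := by
  rw [rowMap_apply]
  simp only [map_pow, map_mul, map_sub, Polynomial.aeval_X, map_one]
  rw [oneSubPow_neg_one_mul_sub_one, mul_pow, mul_pow, ← oneSubPow_nsmul, oneSubPow_nat,
    show -2 * a - 1 - 2 * (k : ℂ) = -(2 * a + 1) + k * (-2) by ring, oneSubPow_add,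
    show (PowerSeries.X - 1 : PowerSeries ℂ) = (-1) * (1 - PowerSeries.X) by ring, mul_pow]
  ring

lemma rowMap_two_mul_sub_one_mul_pow (a : ℂ) (k : ℕ) :
    rowMap a ((2 * Polynomial.X - 1) * (Polynomial.X * (Polynomial.X - 1)) ^ k) =
      PowerSeries.X ^ k * ((-1) ^ k * ((2 * PowerSeries.X - 1) * oneSubPow k)
        - (1 + PowerSeries.X) * oneSubPow (-2 * a - 2 - 2 * k)) := by
  have h2 : (2 * oneSubPow (-1) - 1) = (1 + PowerSeries.X) * oneSubPow (-1) := by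
    linear_combination oneSubPow_neg_one_mul
  rw [rowMap_apply]
  simp only [map_pow, map_mul, map_sub, Polynomial.aeval_X, map_one, map_ofNat]
  rw [oneSubPow_neg_one_mul_sub_one, mul_pow, mul_pow, ← oneSubPow_nsmul, oneSubPow_nat, h2,
    show -2 * a - 2 - 2 * (k : ℂ) = -(2 * a + 1) + (-1) + k * (-2) by ring, oneSubPow_add,
    oneSubPow_add,
    show (PowerSeries.X - 1 : PowerSeries ℂ) = (-1) * (1 - PowerSeries.X) by ring, mul_pow]
  ring

lemma coeff_even_rowMap_pow (a : ℂ) (j k : ℕ) :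
    PowerSeries.coeff (2 * j)
      (oneSubPow (a + j) * rowMap a ((Polynomial.X * (Polynomial.X - 1)) ^ k)) = 0 := by
  rw [rowMap_pow, mul_left_comm, PowerSeries.coeff_X_pow_mul']
  split_ifs with h
  · obtain ⟨n, hn⟩ := Nat.exists_eq_add_of_le h
    rw [hn, Nat.add_sub_cancel_left, mul_sub, mul_left_comm, ← oneSubPow_add, ← oneSubPow_add,
      map_sub]
    have hr := coeff_oneSubPow_reflect (a + j + k) n
    have hc : (2 * j : ℂ) = k + n := by exact_mod_cast hn
    rw [show (n : ℂ) - 1 - (a + j + k) = a + j + (-2 * a - 1 - 2 * k) by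
      linear_combination (-1) * hc] at hr
    have hk : ((-1 : PowerSeries ℂ)) ^ k = PowerSeries.C ((-1) ^ k) := by simp
    have hp : ((-1 : ℂ)) ^ k = (-1) ^ n := by
      rw [neg_one_pow_eq_pow_mod_two, neg_one_pow_eq_pow_mod_two (n := n)]
      congr 1; omega
    rw [hr, hk, PowerSeries.coeff_C_mul, hp, sub_self]
  · rfl

/-- The generalized binomial coefficient with an integral lower index, zero when it is negative. -/
noncomputable def zbinom (x : ℂ) : ℤ → ℂ
  | Int.ofNat n => gbinom x n
  | Int.negSucc _ => 0

lemma zbinom_natCast (x : ℂ) (n : ℕ) : zbinom x n = gbinom x n := rfl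

lemma zbinom_of_neg (x : ℂ) {n : ℤ} (h : n < 0) : zbinom x n = 0 := by
  obtain ⟨m, rfl⟩ := Int.eq_negSucc_of_lt_zero h
  rfl

lemma zbinom_zero (x : ℂ) : zbinom x 0 = 1 := gbinom_zero x

/-- The even-column entry of the reduced matrix, up to the factor `-2`. -/
noncomputable def evenEntry (a : ℂ) (k j : ℕ) : ℂ :=
  zbinom (a + k + j) (2 * j - k) + 2 * zbinom (a + k + j) (2 * j - k - 1)

/-- The odd-column entry of the reduced matrix, up to the factor `-2`. -/
noncomputable def oddEntry (a : ℂ) (k j : ℕ) : ℂ :=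
  2 * zbinom (a + k + j) (2 * j - k + 1) + zbinom (a + k + j) (2 * j - k)

lemma coeff_X_mul_oneSubPow (β : ℂ) (n : ℕ) :
    PowerSeries.coeff n (PowerSeries.X * oneSubPow β) = -(-1) ^ n * zbinom β (n - 1) := by
  cases n with
  | zero => simp [zbinom_of_neg]
  | succ n =>
    rw [PowerSeries.coeff_succ_X_mul, coeff_oneSubPow]
    simp [zbinom_natCast, pow_succ]

lemma gbinom_add_one_eq (x : ℂ) (n : ℕ) : gbinom (x + 1) n = gbinom x n + zbinom x (n - 1) := by
  cases n with
  | zero => simp [zbinom_of_neg]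
  | succ n => rw [gbinom_pascal]; simp [zbinom_natCast]

lemma neg_one_pow_mul_zbinom_reflect (x : ℂ) (n : ℕ) :
    zbinom (n - 2 - x) (n - 1) = -(-1) ^ n * zbinom x (n - 1) := by
  cases n with
  | zero => simp [zbinom_of_neg]
  | succ n =>
    have := gbinom_reflect x n
    simp only [Nat.cast_succ, add_sub_cancel_right, zbinom_natCast, pow_succ]
    rw [show (n : ℂ) + 1 - 2 - x = n - 1 - x by ring, this]
    ring

lemma coeff_even_rowMap_mul_pow (a : ℂ) (j k : ℕ) :
    PowerSeries.coeff (2 * j) (oneSubPow (a + j) *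
      rowMap a ((2 * Polynomial.X - 1) * (Polynomial.X * (Polynomial.X - 1)) ^ k)) =
        -2 * evenEntry a k j := by
  rw [rowMap_two_mul_sub_one_mul_pow, mul_left_comm, PowerSeries.coeff_X_pow_mul']
  split_ifs with h
  · obtain ⟨n, hn⟩ := Nat.exists_eq_add_of_le h
    have hc : (2 * j : ℂ) = k + n := by exact_mod_cast hn
    have hz : (2 * j - k : ℤ) = n := by omega
    have hp : ((-1 : ℂ)) ^ k = (-1) ^ n := by
      rw [neg_one_pow_eq_pow_mod_two, neg_one_pow_eq_pow_mod_two (n := n)]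
      congr 1; omega
    have hk : ((-1 : PowerSeries ℂ)) ^ k = PowerSeries.C ((-1) ^ k) := by simp
    have e : oneSubPow (a + j) * ((-1) ^ k * ((2 * PowerSeries.X - 1) * oneSubPow k)
        - (1 + PowerSeries.X) * oneSubPow (-2 * a - 2 - 2 * k)) =
        PowerSeries.C ((-1) ^ k) * (PowerSeries.X * oneSubPow (a + k + j)
          + PowerSeries.X * oneSubPow (a + k + j) - oneSubPow (a + k + j))
        - (oneSubPow (n - 2 - (a + k + j)) + PowerSeries.X * oneSubPow (n - 2 - (a + k + j))) := by
      have h1 : oneSubPow (n - 2 - (a + k + j)) =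
          oneSubPow (a + j) * oneSubPow (-2 * a - 2 - 2 * k) := by
        rw [← oneSubPow_add]
        congr 1
        linear_combination (-1) * hc
      have h2 : oneSubPow (a + k + j) = oneSubPow (a + j) * oneSubPow k := by
        rw [← oneSubPow_add]
        congr 1
        ring
      rw [hk, h1, h2]
      ring
    have hr := gbinom_reflect (a + k + j + 1) n
    rw [show (n : ℂ) - 1 - (a + k + j + 1) = n - 2 - (a + k + j) by ring, gbinom_add_one_eq] at hr
    rw [hn, Nat.add_sub_cancel_left, e, map_sub, PowerSeries.coeff_C_mul, map_sub, map_add, map_add,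
      coeff_X_mul_oneSubPow, coeff_X_mul_oneSubPow, coeff_oneSubPow, coeff_oneSubPow, hr,
      neg_one_pow_mul_zbinom_reflect, hp, evenEntry, hz, zbinom_natCast]
    have hs : ((-1 : ℂ) ^ n) * (-1) ^ n = 1 := by rw [← mul_pow]; simp
    linear_combination (-2 * gbinom (a + k + j) n - 4 * zbinom (a + k + j) (n - 1)) * hs
  · rw [evenEntry, zbinom_of_neg _ (by omega), zbinom_of_neg _ (by omega)]
    ring

lemma coeff_odd_rowMap_pow (a : ℂ) (j k : ℕ) :
    PowerSeries.coeff (2 * j + 1) ((2 - PowerSeries.X) * oneSubPow (a + j) *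
      rowMap a ((Polynomial.X * (Polynomial.X - 1)) ^ k)) = -2 * oddEntry a k j := by
  rw [rowMap_pow, mul_left_comm, PowerSeries.coeff_X_pow_mul']
  split_ifs with h
  · obtain ⟨n, hn⟩ := Nat.exists_eq_add_of_le h
    have hc : (2 * j + 1 : ℂ) = k + n := by exact_mod_cast hn
    have hz : (2 * j - k + 1 : ℤ) = n := by omega
    have hz' : (2 * j - k : ℤ) = n - 1 := by omega
    have hp : ((-1 : ℂ)) ^ k = -(-1) ^ n := by
      rw [← mul_neg_one ((-1 : ℂ) ^ n), ← pow_succ, neg_one_pow_eq_pow_mod_two,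
        neg_one_pow_eq_pow_mod_two (n := n + 1)]
      congr 1; omega
    have hk : ((-1 : PowerSeries ℂ)) ^ k = PowerSeries.C ((-1) ^ k) := by simp
    have e : (2 - PowerSeries.X) * oneSubPow (a + j) *
        ((-1) ^ k * oneSubPow k - oneSubPow (-2 * a - 1 - 2 * k)) =
        PowerSeries.C ((-1) ^ k) * (oneSubPow (a + k + j) + oneSubPow (a + k + j)
          - PowerSeries.X * oneSubPow (a + k + j))
        - (oneSubPow (n - 2 - (a + k + j)) + oneSubPow (n - 2 - (a + k + j))
          - PowerSeries.X * oneSubPow (n - 2 - (a + k + j))) := by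
      have h1 : oneSubPow (n - 2 - (a + k + j)) =
          oneSubPow (a + j) * oneSubPow (-2 * a - 1 - 2 * k) := by
        rw [← oneSubPow_add]
        congr 1
        linear_combination (-1) * hc
      have h2 : oneSubPow (a + k + j) = oneSubPow (a + j) * oneSubPow k := by
        rw [← oneSubPow_add]
        congr 1
        ring
      rw [hk, h1, h2]
      ring
    have hr := gbinom_reflect (a + k + j + 1) n
    rw [show (n : ℂ) - 1 - (a + k + j + 1) = n - 2 - (a + k + j) by ring, gbinom_add_one_eq] at hr
    rw [hn, Nat.add_sub_cancel_left, e, map_sub, PowerSeries.coeff_C_mul, map_sub, map_add, map_sub,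
      map_add,
      coeff_X_mul_oneSubPow, coeff_X_mul_oneSubPow, coeff_oneSubPow, coeff_oneSubPow, hr,
      neg_one_pow_mul_zbinom_reflect, hp, oddEntry, hz, hz', zbinom_natCast]
    have hs : ((-1 : ℂ) ^ n) * (-1) ^ n = 1 := by rw [← mul_pow]; simp
    linear_combination (-4 * gbinom (a + k + j) n - 2 * zbinom (a + k + j) (n - 1)) * hs
  · rw [oddEntry, zbinom_of_neg _ (by omega), zbinom_of_neg _ (by omega)]
    ring

lemma mul_zbinom (x : ℂ) (n : ℤ) : (n : ℂ) * zbinom x n = (x - n + 1) * zbinom x (n - 1) := by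
  rcases lt_or_ge n 0 with h | h
  · rw [zbinom_of_neg _ h, zbinom_of_neg _ (by omega)]
    ring
  · lift n to ℕ using h
    cases n with
    | zero => simp [zbinom_of_neg]
    | succ n =>
      have := gbinom_succ x n
      rw [zbinom_natCast, show ((n + 1 : ℕ) : ℤ) - 1 = (n : ℤ) by push_cast; ring, zbinom_natCast]
      push_cast
      linear_combination this

lemma mul_zbinom_add_one (x : ℂ) (n : ℤ) :
    (x + 1 - n) * zbinom (x + 1) n = (x + 1) * zbinom x n := by
  rcases lt_or_ge n 0 with h | h
  · rw [zbinom_of_neg _ h, zbinom_of_neg _ h]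
    ring
  · lift n to ℕ using h
    have := mul_zbinom x n
    rw [zbinom_natCast, gbinom_add_one_eq, zbinom_natCast] at *
    linear_combination (-1) * this

/-- The unnormalized coefficients of the even column operation. -/
noncomputable def evenWeight (a : ℂ) (m j : ℕ) : ℂ :=
  ∏ i ∈ Finset.range j, (-2 * (2 * i + 1) * (m - i) * (a + m + 1 + i) /
    ((a + i + 1) * (a + 2 * m - i) * (a + 2 * m + 2 + i)))

/-- The unnormalized coefficients of the odd column operation. -/
noncomputable def oddWeight (a : ℂ) (m j : ℕ) : ℂ :=
  ∏ i ∈ Finset.range j, (-2 * (2 * i + 3) * (m - i) * (a + m + 1 + i) * (a + 3 * i + 5) /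
    ((a + i) * (a + 2 * m - 1 - i) * (a + 2 * m + 3 + i) * (a + 3 * i + 2)))

lemma add_intCast_ne_zero {a : ℂ} (ha : ∀ i : ℤ, 2 * a + i ≠ 0) (i : ℤ) : a + i ≠ 0 := by
  intro h
  apply ha (2 * i)
  push_cast
  linear_combination 2 * h

lemma evenWeight_succ {a : ℂ} (ha : ∀ i : ℤ, 2 * a + i ≠ 0) (m j : ℕ) :
    evenWeight a m (j + 1) * ((a + j + 1) * (a + 2 * m - j) * (a + 2 * m + 2 + j)) =
      -2 * (2 * j + 1) * (m - j) * (a + m + 1 + j) * evenWeight a m j := by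
  have h1 : a + j + 1 ≠ 0 := by simpa [add_assoc] using add_intCast_ne_zero ha (j + 1)
  have h2 : a + 2 * m - j ≠ 0 := by
    simpa [add_sub_assoc] using add_intCast_ne_zero ha (2 * m - j)
  have h3 : a + 2 * m + 2 + j ≠ 0 := by
    simpa [add_assoc] using add_intCast_ne_zero ha (2 * m + 2 + j)
  rw [evenWeight, Finset.prod_range_succ, ← evenWeight]
  field_simp

lemma oddWeight_succ {a : ℂ} (ha : ∀ i : ℤ, 2 * a + i ≠ 0) (m j : ℕ) :
    oddWeight a m (j + 1) *
        ((a + j) * (a + 2 * m - 1 - j) * (a + 2 * m + 3 + j) * (a + 3 * j + 2)) =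
      -2 * (2 * j + 3) * (m - j) * (a + m + 1 + j) * (a + 3 * j + 5) * oddWeight a m j := by
  have h1 : a + j ≠ 0 := by simpa using add_intCast_ne_zero ha j
  have h2 : a + 2 * m - 1 - j ≠ 0 := by
    simpa [add_sub_assoc] using add_intCast_ne_zero ha (2 * m - 1 - j)
  have h3 : a + 2 * m + 3 + j ≠ 0 := by
    simpa [add_assoc] using add_intCast_ne_zero ha (2 * m + 3 + j)
  have h4 : a + 3 * j + 2 ≠ 0 := by
    simpa [add_assoc] using add_intCast_ne_zero ha (3 * j + 2)
  rw [oddWeight, Finset.prod_range_succ, ← oddWeight]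
  generalize a + 3 * (j : ℂ) + 2 = q at *
  field_simp

/-- The telescoping certificate for the recurrence satisfied by the even column sums. -/
noncomputable def evenCert (a : ℂ) (m k j : ℕ) : ℂ :=
  -(2 * a + 3 * k + 4) * evenWeight a m j * (a + j) * (a + 2 * m - j + 1) * (a + 2 * m + 1 + j) *
    zbinom (a + k + j) (2 * j - k - 2) / (a + 2 * k - j + 3)

lemma evenCert_succ_sub {a : ℂ} (ha : ∀ i : ℤ, 2 * a + i ≠ 0) (m k j : ℕ) :
    evenCert a m k (j + 1) - evenCert a m k j =
      (k + 1) * (2 * m - k) * (2 * a + k + 2 * m + 2) * (evenWeight a m j * evenEntry a k j) -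
      2 * (k + 1 - m) * (a + k + m + 2) * (2 * a + 2 * k + 3) *
        (evenWeight a m j * evenEntry a (k + 1) j) := by
  have hd : ∀ i : ℤ, a + 2 * k - j + i ≠ 0 := fun i => by
    have := add_intCast_ne_zero ha (2 * k - j + i)
    push_cast at this
    convert this using 1
    ring
  have h1 : a + 2 * k - j + 1 ≠ 0 := by simpa using hd 1
  have h2 : a + 2 * k - j + 2 ≠ 0 := by simpa using hd 2
  have h3 : a + 2 * k - j + 3 ≠ 0 := by simpa using hd 3
  have hw := evenWeight_succ ha m j
  have e1 : zbinom (a + k + j) (2 * j - k - 1) =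
      (2 * j - k) * zbinom (a + k + j) (2 * j - k) / (a + 2 * k - j + 1) := by
    rw [eq_div_iff h1]
    have := mul_zbinom (a + k + j) (2 * j - k)
    push_cast at this
    linear_combination (-1) * this
  have e2 : zbinom (a + k + j) (2 * j - k - 2) =
      (2 * j - k - 1) * zbinom (a + k + j) (2 * j - k - 1) / (a + 2 * k - j + 2) := by
    rw [eq_div_iff h2]
    have := mul_zbinom (a + k + j) (2 * j - k - 1)
    rw [show (2 * j - k - 1 - 1 : ℤ) = 2 * j - k - 2 by ring] at this
    push_cast at this
    linear_combination (-1) * this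
  have e3 : zbinom (a + k + j + 1) (2 * j - k) =
      (a + k + j + 1) * zbinom (a + k + j) (2 * j - k) / (a + 2 * k - j + 1) := by
    rw [eq_div_iff h1]
    have := mul_zbinom_add_one (a + k + j) (2 * j - k)
    push_cast at this
    linear_combination this
  have e4 : zbinom (a + k + j + 1) (2 * j - k - 1) =
      (a + k + j + 1) * zbinom (a + k + j) (2 * j - k - 1) / (a + 2 * k - j + 2) := by
    rw [eq_div_iff h2]
    have := mul_zbinom_add_one (a + k + j) (2 * j - k - 1)
    push_cast at this
    linear_combination this
  have e5 : zbinom (a + k + j + 1) (2 * j - k - 2) =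
      (a + k + j + 1) * zbinom (a + k + j) (2 * j - k - 2) / (a + 2 * k - j + 3) := by
    rw [eq_div_iff h3]
    have := mul_zbinom_add_one (a + k + j) (2 * j - k - 2)
    push_cast at this
    linear_combination this
  have c1 : evenCert a m k (j + 1) = -(2 * a + 3 * k + 4) *
      (-2 * (2 * j + 1) * (m - j) * (a + m + 1 + j) * evenWeight a m j) *
        zbinom (a + k + j + 1) (2 * j - k) / (a + 2 * k - j + 2) := by
    rw [evenCert, ← hw]
    push_cast
    rw [show (2 * (j + 1) - k - 2 : ℤ) = 2 * j - k by ring,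
      show a + k + (j + 1 : ℂ) = a + k + j + 1 by ring,
      show a + 2 * k - (j + 1 : ℂ) + 3 = a + 2 * k - j + 2 by ring]
    ring
  rw [c1, evenCert, evenEntry, evenEntry]
  push_cast
  rw [show a + (k + 1 : ℂ) + j = a + k + j + 1 by ring,
    show (2 * j - (k + 1) : ℤ) = 2 * j - k - 1 by ring,
    show (2 * j - k - 1 - 1 : ℤ) = 2 * j - k - 2 by ring, e5, e4, e3, e2, e1]
  generalize zbinom (a + k + j) (2 * j - k) = g
  generalize evenWeight a m j = w
  field_simp
  ring

/-- The telescoping certificate for the recurrence satisfied by the odd column sums. -/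
noncomputable def oddCert (a : ℂ) (m k j : ℕ) : ℂ :=
  -(2 * a + 3 * k + 3) * oddWeight a m j * (a + j - 1) * (a + 2 * m - j) * (a + 2 * m + 2 + j) /
    (a + 3 * j + 2) * zbinom (a + k + j) (2 * j - k - 1) / (a + 2 * k - j + 2)

lemma oddCert_succ_sub {a : ℂ} (ha : ∀ i : ℤ, 2 * a + i ≠ 0) (m k j : ℕ) :
    oddCert a m k (j + 1) - oddCert a m k j =
      (k + 2) * (2 * m + 1 - k) * (2 * a + k + 2 * m + 1) *
        (oddWeight a m j * oddEntry a k j / (2 * a + 3 * k + 1)) -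
      2 * (k + 1 - m) * (a + k + m + 2) * (2 * a + 2 * k + 1) *
        (oddWeight a m j * oddEntry a (k + 1) j / (2 * a + 3 * (k + 1) + 1)) := by
  have hd : ∀ i : ℤ, a + 2 * k - j + i ≠ 0 := fun i => by
    have := add_intCast_ne_zero ha (2 * k - j + i)
    push_cast at this
    convert this using 1
    ring
  have h0 : a + 2 * k - j ≠ 0 := by simpa using hd 0
  have h1 : a + 2 * k - j + 1 ≠ 0 := by simpa using hd 1
  have h2 : a + 2 * k - j + 2 ≠ 0 := by simpa using hd 2
  have h4 : a + 3 * j + 2 ≠ 0 := by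
    simpa [add_assoc] using add_intCast_ne_zero ha (3 * j + 2)
  have h5 : a + 3 * j + 5 ≠ 0 := by
    simpa [add_assoc] using add_intCast_ne_zero ha (3 * j + 5)
  have h6 : 2 * a + 3 * k + 1 ≠ 0 := by simpa [add_assoc] using ha (3 * k + 1)
  have h7 : 2 * a + 3 * (k + 1) + 1 ≠ 0 := by simpa [add_assoc] using ha (3 * (k + 1) + 1)
  have hw := oddWeight_succ ha m j
  have e1 : zbinom (a + k + j) (2 * j - k) =
      (2 * j - k + 1) * zbinom (a + k + j) (2 * j - k + 1) / (a + 2 * k - j) := by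
    rw [eq_div_iff h0]
    have := mul_zbinom (a + k + j) (2 * j - k + 1)
    rw [add_sub_cancel_right] at this
    push_cast at this
    linear_combination (-1) * this
  have e2 : zbinom (a + k + j) (2 * j - k - 1) =
      (2 * j - k) * zbinom (a + k + j) (2 * j - k) / (a + 2 * k - j + 1) := by
    rw [eq_div_iff h1]
    have := mul_zbinom (a + k + j) (2 * j - k)
    push_cast at this
    linear_combination (-1) * this
  have e3 : zbinom (a + k + j + 1) (2 * j - k + 1) =
      (a + k + j + 1) * zbinom (a + k + j) (2 * j - k + 1) / (a + 2 * k - j) := by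
    rw [eq_div_iff h0]
    have := mul_zbinom_add_one (a + k + j) (2 * j - k + 1)
    push_cast at this
    linear_combination this
  have e4 : zbinom (a + k + j + 1) (2 * j - k) =
      (a + k + j + 1) * zbinom (a + k + j) (2 * j - k) / (a + 2 * k - j + 1) := by
    rw [eq_div_iff h1]
    have := mul_zbinom_add_one (a + k + j) (2 * j - k)
    push_cast at this
    linear_combination this
  have e5 : zbinom (a + k + j + 1) (2 * j - k - 1) =
      (a + k + j + 1) * zbinom (a + k + j) (2 * j - k - 1) / (a + 2 * k - j + 2) := by
    rw [eq_div_iff h2]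
    have := mul_zbinom_add_one (a + k + j) (2 * j - k - 1)
    push_cast at this
    linear_combination this
  have c1 : oddCert a m k (j + 1) = -(2 * a + 3 * k + 3) *
      (-2 * (2 * j + 3) * (m - j) * (a + m + 1 + j) * oddWeight a m j / (a + 3 * j + 2)) *
        zbinom (a + k + j + 1) (2 * j - k + 1) / (a + 2 * k - j + 1) := by
    have hw' : oddWeight a m (j + 1) * (a + j) * (a + 2 * m - 1 - j) * (a + 2 * m + 3 + j) /
        (a + 3 * j + 5) =
        -2 * (2 * j + 3) * (m - j) * (a + m + 1 + j) * oddWeight a m j / (a + 3 * j + 2) := by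
      rw [div_eq_div_iff h5 h4]
      linear_combination hw
    rw [oddCert, ← hw']
    push_cast
    rw [show (2 * (j + 1) - k - 1 : ℤ) = 2 * j - k + 1 by ring,
      show a + k + (j + 1 : ℂ) = a + k + j + 1 by ring,
      show a + 2 * k - (j + 1 : ℂ) + 2 = a + 2 * k - j + 1 by ring,
      show a + 3 * (j + 1 : ℂ) + 2 = a + 3 * j + 5 by ring]
    ring
  rw [c1, oddCert, oddEntry, oddEntry]
  push_cast
  rw [show a + (k + 1 : ℂ) + j = a + k + j + 1 by ring,
    show (2 * j - (k + 1) : ℤ) = 2 * j - k - 1 by ring,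
    show (2 * j - k - 1 + 1 : ℤ) = 2 * j - k by ring, e5, e4, e3, e2, e1]
  generalize zbinom (a + k + j) (2 * j - k + 1) = g
  generalize oddWeight a m j = w
  field_simp
  ring

lemma poch_succ (x : ℂ) (k : ℕ) : poch x (k + 1) = poch x k * (x + k) := by
  rw [poch, Finset.prod_range_succ, poch]

@[simp]
lemma poch_zero (x : ℂ) : poch x 0 = 1 := by simp [poch]

lemma poch_ne_zero {x : ℂ} (h : ∀ i : ℕ, x + i ≠ 0) (k : ℕ) : poch x k ≠ 0 :=
  Finset.prod_ne_zero_iff.2 fun i _ => h i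

/-- The combination of even columns given by `evenWeight`. -/
noncomputable def evenSum (a : ℂ) (m k : ℕ) : ℂ :=
  ∑ j ∈ Finset.range (m + 1), evenWeight a m j * evenEntry a k j

/-- The combination of odd columns given by `oddWeight`. -/
noncomputable def oddSum (a : ℂ) (m k : ℕ) : ℂ :=
  ∑ j ∈ Finset.range (m + 1), oddWeight a m j * oddEntry a k j

lemma evenWeight_succ_self (a : ℂ) (m : ℕ) : evenWeight a m (m + 1) = 0 := by
  simp [evenWeight, Finset.prod_range_succ]

lemma oddWeight_succ_self (a : ℂ) (m : ℕ) : oddWeight a m (m + 1) = 0 := by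
  simp [oddWeight, Finset.prod_range_succ]

lemma evenSum_recurrence {a : ℂ} (ha : ∀ i : ℤ, 2 * a + i ≠ 0) (m k : ℕ) :
    (k + 1) * (2 * m - k) * (2 * a + k + 2 * m + 2) * evenSum a m k =
      2 * (k + 1 - m) * (a + k + m + 2) * (2 * a + 2 * k + 3) * evenSum a m (k + 1) := by
  rw [evenSum, evenSum, Finset.mul_sum, Finset.mul_sum, ← sub_eq_zero, ← Finset.sum_sub_distrib,
    ← Finset.sum_congr rfl fun j _ => evenCert_succ_sub ha m k j, Finset.sum_range_sub, evenCert,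
    evenCert, evenWeight_succ_self, zbinom_of_neg _ (n := 2 * (0 : ℕ) - k - 2) (by omega)]
  simp

lemma oddSum_recurrence {a : ℂ} (ha : ∀ i : ℤ, 2 * a + i ≠ 0) (m k : ℕ) :
    (k + 2) * (2 * m + 1 - k) * (2 * a + k + 2 * m + 1) * (oddSum a m k / (2 * a + 3 * k + 1)) =
      2 * (k + 1 - m) * (a + k + m + 2) * (2 * a + 2 * k + 1) *
        (oddSum a m (k + 1) / (2 * a + 3 * (k + 1) + 1)) := by
  rw [oddSum, oddSum, Finset.sum_div, Finset.sum_div, Finset.mul_sum, Finset.mul_sum,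
    ← sub_eq_zero, ← Finset.sum_sub_distrib,
    ← Finset.sum_congr rfl fun j _ => oddCert_succ_sub ha m k j, Finset.sum_range_sub, oddCert,
    oddCert, oddWeight_succ_self, zbinom_of_neg _ (n := 2 * (0 : ℕ) - k - 1) (by omega)]
  simp

lemma evenSum_eq_zero {a : ℂ} (ha : ∀ i : ℤ, 2 * a + i ≠ 0) {m k : ℕ} (h : k < m) :
    evenSum a m k = 0 := by
  obtain ⟨d, hd⟩ := Nat.exists_eq_add_of_lt h
  induction d generalizing k with
  | zero =>
    have hr := evenSum_recurrence ha m k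
    have h1 : (k + 1 : ℂ) ≠ 0 := Nat.cast_add_one_ne_zero k
    have h2 : (2 * m - k : ℂ) ≠ 0 := sub_ne_zero.2 (by norm_cast; omega)
    have h3 : 2 * a + k + 2 * m + 2 ≠ 0 := by simpa [add_assoc] using ha (k + 2 * m + 2)
    have h4 : (k + 1 - m : ℂ) = 0 := by rw [hd]; push_cast; ring
    rw [h4] at hr
    simpa [h1, h2, h3] using hr
  | succ d ih =>
    have hr := evenSum_recurrence ha m k
    have h1 : (k + 1 : ℂ) ≠ 0 := Nat.cast_add_one_ne_zero k
    have h2 : (2 * m - k : ℂ) ≠ 0 := sub_ne_zero.2 (by norm_cast; omega)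
    have h3 : 2 * a + k + 2 * m + 2 ≠ 0 := by simpa [add_assoc] using ha (k + 2 * m + 2)
    rw [ih (k := k + 1) (by omega) (by omega)] at hr
    simpa [h1, h2, h3] using hr

lemma oddSum_eq_zero {a : ℂ} (ha : ∀ i : ℤ, 2 * a + i ≠ 0) {m k : ℕ} (h : k < m) :
    oddSum a m k = 0 := by
  obtain ⟨d, hd⟩ := Nat.exists_eq_add_of_lt h
  have h1 : (k + 2 : ℂ) ≠ 0 := by norm_cast
  have h2 : (2 * m + 1 - k : ℂ) ≠ 0 := sub_ne_zero.2 (by norm_cast; omega)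
  have h3 : 2 * a + k + 2 * m + 1 ≠ 0 := by simpa [add_assoc] using ha (k + 2 * m + 1)
  have h5 : 2 * a + 3 * k + 1 ≠ 0 := by simpa [add_assoc] using ha (3 * k + 1)
  induction d generalizing k with
  | zero =>
    have hr := oddSum_recurrence ha m k
    have h4 : (k + 1 - m : ℂ) = 0 := by rw [hd]; push_cast; ring
    rw [h4] at hr
    simpa [h1, h2, h3, h5] using hr
  | succ d ih =>
    have hr := oddSum_recurrence ha m k
    rw [ih (k := k + 1) (by omega) (by omega) (by norm_cast)
      (sub_ne_zero.2 (by norm_cast; omega))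
      (by simpa [add_assoc] using ha ((k + 1 : ℕ) + 2 * m + 1))
      (by simpa [add_assoc] using ha (3 * (k + 1 : ℕ) + 1))] at hr
    simpa [h1, h2, h3, h5] using hr

lemma evenSum_two_mul (a : ℂ) (m : ℕ) : evenSum a m (2 * m) = evenWeight a m m := by
  rw [evenSum, Finset.sum_range_succ, Finset.sum_eq_zero, zero_add, evenEntry]
  · push_cast
    rw [sub_self, zbinom_zero, zbinom_of_neg _ (by norm_num)]
    ring
  · intro j hj
    have := Finset.mem_range.1 hj
    rw [evenEntry, zbinom_of_neg _ (by push_cast; omega), zbinom_of_neg _ (by push_cast; omega)]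
    ring

lemma oddSum_two_mul_add_one (a : ℂ) (m : ℕ) :
    oddSum a m (2 * m + 1) = 2 * oddWeight a m m := by
  rw [oddSum, Finset.sum_range_succ, Finset.sum_eq_zero, zero_add, oddEntry]
  · push_cast
    rw [show (2 * m - (2 * m + 1) + 1 : ℤ) = 0 by ring, zbinom_zero,
      zbinom_of_neg _ (n := 2 * (m : ℤ) - (2 * m + 1)) (by omega)]
    ring
  · intro j hj
    have := Finset.mem_range.1 hj
    rw [oddEntry, zbinom_of_neg _ (by push_cast; omega), zbinom_of_neg _ (by push_cast; omega)]
    ring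

lemma prod_range_natCast_sub (m : ℕ) :
    ∏ i ∈ Finset.range m, ((m : ℂ) - i) = ∏ i ∈ Finset.range m, ((i : ℂ) + 1) := by
  rw [← Finset.prod_range_reflect]
  refine Finset.prod_congr rfl fun i hi => ?_
  have := Finset.mem_range.1 hi
  rw [show m - 1 - i = m - (1 + i) by omega, Nat.cast_sub (by omega)]
  push_cast
  ring

lemma prod_range_add_one_ne_zero (m : ℕ) : ∏ i ∈ Finset.range m, ((i : ℂ) + 1) ≠ 0 :=
  Finset.prod_ne_zero_iff.2 fun i _ => Nat.cast_add_one_ne_zero i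

lemma evenSum_self {a : ℂ} (ha : ∀ i : ℤ, 2 * a + i ≠ 0) (m : ℕ) :
    evenSum a m m * (poch (m + 1) m * poch (2 * a + 3 * m + 2) m) =
      evenWeight a m m * (4 ^ m * poch (a + 2 * m + 2) m * poch (a + m + 3 / 2) m) := by
  have key : ∀ d : ℕ, evenSum a m m * ((∏ i ∈ Finset.range d, ((m : ℂ) - i)) *
      (poch (m + 1) d * poch (2 * a + 3 * m + 2) d)) =
        (∏ i ∈ Finset.range d, ((i : ℂ) + 1)) * (4 ^ d * poch (a + 2 * m + 2) d *
          poch (a + m + 3 / 2) d) * evenSum a m (m + d) := by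
    intro d
    induction d with
    | zero => simp
    | succ d ih =>
      have hr := evenSum_recurrence ha m (m + d)
      rw [Finset.prod_range_succ, Finset.prod_range_succ, poch_succ, poch_succ, poch_succ,
        poch_succ, ← add_assoc]
      push_cast at hr
      generalize evenSum a m (m + d + 1) = T at *
      generalize evenSum a m (m + d) = U at *
      linear_combination ((m : ℂ) - d) * (m + 1 + d) * (2 * a + 3 * m + 2 + d) * ih +
        (∏ i ∈ Finset.range d, ((i : ℂ) + 1)) * (4 ^ d * poch (a + 2 * m + 2) d *
          poch (a + m + 3 / 2) d) * hr
  have h := key m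
  rw [← two_mul, evenSum_two_mul, prod_range_natCast_sub] at h
  apply mul_left_cancel₀ (prod_range_add_one_ne_zero m)
  linear_combination h

lemma oddSum_self {a : ℂ} (ha : ∀ i : ℤ, 2 * a + i ≠ 0) (m : ℕ) :
    oddSum a m m * (poch (m + 2) (m + 1) * poch (2 * a + 3 * m + 1) (m + 1) * (a + 3 * m + 2)) =
      oddWeight a m m * ((2 * a + 3 * m + 1) * (4 ^ (m + 1) * poch (a + 2 * m + 2) (m + 1) *
        poch (a + m + 1 / 2) (m + 1))) := by
  have key : ∀ d : ℕ, oddSum a m m / (2 * a + 3 * m + 1) *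
      ((∏ i ∈ Finset.range d, ((m + 1 : ℕ) - (i : ℂ))) *
        (poch (m + 2) d * poch (2 * a + 3 * m + 1) d)) =
        (∏ i ∈ Finset.range d, ((i : ℂ) + 1)) * (4 ^ d * poch (a + 2 * m + 2) d *
          poch (a + m + 1 / 2) d) * (oddSum a m (m + d) / (2 * a + 3 * (m + d : ℕ) + 1)) := by
    intro d
    induction d with
    | zero => simp
    | succ d ih =>
      have hr := oddSum_recurrence ha m (m + d)
      rw [Finset.prod_range_succ, Finset.prod_range_succ, poch_succ, poch_succ, poch_succ,
        poch_succ, ← add_assoc]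
      push_cast at hr ih ⊢
      generalize oddSum a m (m + d + 1) / _ = T at *
      generalize oddSum a m (m + d) / _ = U at *
      linear_combination ((m : ℂ) + 1 - d) * (m + 2 + d) * (2 * a + 3 * m + 1 + d) * ih +
        (∏ i ∈ Finset.range d, ((i : ℂ) + 1)) * (4 ^ d * poch (a + 2 * m + 2) d *
          poch (a + m + 1 / 2) d) * hr
  have h := key (m + 1)
  have h5 : 2 * a + 3 * m + 1 ≠ 0 := by simpa [add_assoc] using ha (3 * m + 1)
  have h6 : a + 3 * m + 2 ≠ 0 := by
    simpa [add_assoc] using add_intCast_ne_zero ha (3 * m + 2)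
  rw [show m + (m + 1) = 2 * m + 1 by ring, oddSum_two_mul_add_one, prod_range_natCast_sub,
    show 2 * a + 3 * (2 * m + 1 : ℕ) + 1 = 2 * (a + 3 * m + 2) by push_cast; ring,
    mul_div_mul_left _ _ two_ne_zero] at h
  apply mul_left_cancel₀ (prod_range_add_one_ne_zero (m + 1))
  rw [div_mul_eq_mul_div, mul_div_assoc', div_eq_div_iff h5 h6] at h
  linear_combination h

lemma sum_antidiagonal_fst_mul_choose (m : ℕ) (f : ℕ → ℕ → ℂ) :
    ∑ p ∈ Finset.HasAntidiagonal.antidiagonal m, (p.1 : ℂ) * m.choose p.1 * f p.1 (p.2 + 1) =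
      ∑ p ∈ Finset.HasAntidiagonal.antidiagonal m, (p.2 : ℂ) * m.choose p.1 * f (p.1 + 1) p.2 := by
  cases m with
  | zero => simp
  | succ m =>
    rw [Finset.Nat.sum_antidiagonal_succ, Finset.Nat.sum_antidiagonal_succ']
    simp only [Nat.cast_zero, zero_mul, zero_add]
    refine Finset.sum_congr rfl fun p hp => ?_
    have hm := Finset.HasAntidiagonal.mem_antidiagonal.1 hp
    have h1 := Nat.add_one_mul_choose_eq m p.1
    have h2 := Nat.choose_mul_succ_eq m p.1
    rw [show m + 1 - p.1 = p.2 + 1 by omega] at h2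
    congr 1
    norm_cast
    rw [mul_comm, ← h1, mul_comm (p.2 + 1), ← h2, mul_comm]

/-- The Pfaff–Saalschütz summation. -/
lemma sum_antidiagonal_saalschuetz (A B C : ℂ) (hC : ∀ i : ℕ, C + i ≠ 0) (m : ℕ) :
    poch C m * ∑ p ∈ Finset.HasAntidiagonal.antidiagonal m, (m.choose p.1 : ℂ) *
        (poch A p.1 * poch B p.1 * poch (C - A - B) p.2 / poch C p.1) =
      poch (C - A) m * poch (C - B) m := by
  induction m with
  | zero => simp
  | succ m ih =>
    set f : ℕ → ℕ → ℂ := fun i j => poch A i * poch B i * poch (C - A - B) j / poch C i with hf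
    have h1 : ∀ i j, f i (j + 1) = (C - A - B + j) * f i j := fun i j => by
      simp only [hf, poch_succ]; ring
    have h2 : ∀ i j, f (i + 1) j = (A + i) * (B + i) / (C + i) * f i j := fun i j => by
      have := hC i
      have := poch_ne_zero hC i
      simp only [hf, poch_succ]
      field_simp
    have h := Finset.sum_antidiagonal_choose_succ_mul (R := ℂ) f m
    have hs : (C + m) * ∑ p ∈ Finset.HasAntidiagonal.antidiagonal (m + 1),
          ((m + 1).choose p.1 : ℂ) * f p.1 p.2 =
        (C - A + m) * (C - B + m) * ∑ p ∈ Finset.HasAntidiagonal.antidiagonal m,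
          (m.choose p.1 : ℂ) * f p.1 p.2 := by
      have hz := sum_antidiagonal_fst_mul_choose m f
      rw [← sub_eq_zero, ← Finset.sum_sub_distrib] at hz
      rw [h, ← Finset.sum_add_distrib, Finset.mul_sum, Finset.mul_sum, ← sub_eq_zero,
        ← Finset.sum_sub_distrib, ← neg_eq_zero, ← hz, ← Finset.sum_neg_distrib]
      refine Finset.sum_congr rfl fun p hp => ?_
      have hm := Finset.HasAntidiagonal.mem_antidiagonal.1 hp
      rw [← Nat.choose_symm_of_eq_add hm.symm, h1, h2, ← hm]
      have := hC p.1
      push_cast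
      field_simp
      ring
    rw [poch_succ, poch_succ, poch_succ]
    linear_combination poch C m * hs + (C - A + m) * (C - B + m) * ih

lemma gbinom_add_one_add_two (x : ℂ) (n : ℕ) :
    ((n : ℂ) + 1) * (n + 2) * gbinom (x + 1) (n + 2) = (x + 1) * (x - n) * gbinom x n := by
  have h1 := gbinom_succ (x + 1) (n + 1)
  have h2 := mul_zbinom_add_one x ((n + 1 : ℕ) : ℤ)
  have h3 := gbinom_succ x n
  rw [zbinom_natCast, zbinom_natCast] at h2
  push_cast at h1 h2
  linear_combination ((n : ℂ) + 1) * h1 + (n + 1) * h2 + (x + 1) * h3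

lemma evenWeight_mul_gbinom {a : ℂ} (ha : ∀ i : ℤ, 2 * a + i ≠ 0) (i j : ℕ) :
    evenWeight a (i + j) i * gbinom (a + i) (2 * i) * poch (a + (i + j : ℕ) + 1) (i + j) =
      ((i + j).choose i : ℂ) * (poch (a + (i + j : ℕ) + 1) i * poch (-a) i *
        poch (a + (i + j : ℕ) + 1) j / poch (a + 2 * (i + j : ℕ) + 2) i) := by
  induction i generalizing j with
  | zero => simp [evenWeight]
  | succ i ih =>
    have h := ih (j + 1)
    rw [show i + (j + 1) = i + 1 + j by ring] at h
    have hc : ((i + 1 + j).choose (i + 1) : ℂ) * (i + 1) = (i + 1 + j).choose i * (j + 1) := by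
      have := Nat.choose_succ_right_eq (i + 1 + j) i
      rw [show i + 1 + j - i = j + 1 by omega] at this
      exact_mod_cast this
    have hg := gbinom_add_one_add_two (a + i) (2 * i)
    have hw := evenWeight_succ ha (i + 1 + j) i
    generalize hM : i + 1 + j = M at *
    have hMc : (M : ℂ) = i + 1 + j := by rw [← hM]; push_cast; ring
    have hC : ∀ l : ℕ, a + 2 * M + 2 + l ≠ 0 := fun l => by
      simpa [add_assoc] using add_intCast_ne_zero ha (2 * M + 2 + l)
    have hC0 := poch_ne_zero hC i
    have hC1 := hC i
    have h1 : a + i + 1 ≠ 0 := by simpa [add_assoc] using add_intCast_ne_zero ha (i + 1)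
    have h2 : a + 2 * M - i ≠ 0 := by
      simpa [add_sub_assoc] using add_intCast_ne_zero ha (2 * M - i)
    have h3 : (i + 1 : ℂ) ≠ 0 := Nat.cast_add_one_ne_zero i
    have h4 : (2 * i + 1 : ℂ) ≠ 0 := by exact_mod_cast Nat.succ_ne_zero (2 * i)
    rw [poch_succ, poch_succ, poch_succ]
    rw [poch_succ (a + M + 1) j, eq_comm, mul_div_assoc', div_eq_iff hC0] at h
    rw [mul_div_assoc', eq_div_iff (mul_ne_zero hC0 hC1)]
    push_cast at hg ⊢
    rw [show a + (i + 1 : ℂ) = a + i + 1 by ring, show 2 * (i + 1) = 2 * i + 2 by ring]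
    have hj : (j : ℂ) = M - i - 1 := by rw [hMc]; ring
    have hne : 2 * (a + i + 1) * (a + 2 * M - i) * (i + 1) * (2 * i + 1) ≠ 0 := by
      simp [h1, h2, h3, h4]
    rw [hj] at h hc
    apply mul_left_cancel₀ hne
    linear_combination
      ((2 * i + 1) * (2 * i + 2) * gbinom (a + i + 1) (2 * i + 2) * poch (a + M + 1) M *
        poch (a + 2 * M + 2) i) * hw +
      (-2 * (2 * i + 1) * (M - i) * (a + M + 1 + i) * evenWeight a M i * poch (a + M + 1) M *
        poch (a + 2 * M + 2) i) * hg +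
      (2 * (2 * i + 1) * (M - i) * (a + M + 1 + i) * (a + i + 1) * (a - i)) * h +
      (2 * (2 * i + 1) * (a + M + 1 + i) * (a + i + 1) * (a - i) * (a + 2 * M - i) *
        poch (a + M + 1) i * poch (-a) i * poch (a + M + 1) j) * hc

/-- The combination of the even entries of the border row given by `evenWeight`. -/
noncomputable def borderSum (a : ℂ) (m : ℕ) : ℂ :=
  ∑ j ∈ Finset.range (m + 1), evenWeight a m j * gbinom (a + j) (2 * j)

lemma borderSum_eq {a : ℂ} (ha : ∀ i : ℤ, 2 * a + i ≠ 0) (m : ℕ) :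
    borderSum a m * (poch (a + m + 1) m * poch (a + 2 * m + 2) m) =
      poch (m + 1) m * poch (2 * a + 2 * m + 2) m := by
  have hC : ∀ l : ℕ, a + 2 * m + 2 + l ≠ 0 := fun l => by
    simpa [add_assoc] using add_intCast_ne_zero ha (2 * m + 2 + l)
  have h := sum_antidiagonal_saalschuetz (a + m + 1) (-a) (a + 2 * m + 2) hC m
  rw [show a + 2 * m + 2 - (a + m + 1) = (m : ℂ) + 1 by ring,
    show a + 2 * m + 2 - (-a) = 2 * a + 2 * m + 2 by ring,
    show (m : ℂ) + 1 - (-a) = a + m + 1 by ring] at h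
  rw [← h, borderSum, ← Finset.Nat.sum_antidiagonal_eq_sum_range_succ_mk
    (f := fun p : ℕ × ℕ => evenWeight a m p.1 * gbinom (a + p.1) (2 * p.1)), ← mul_assoc,
    mul_comm, Finset.sum_mul]
  congr 1
  refine Finset.sum_congr rfl fun p hp => ?_
  have := evenWeight_mul_gbinom ha p.1 p.2
  rwa [Finset.HasAntidiagonal.mem_antidiagonal.1 hp] at this

lemma evenWeight_self {a : ℂ} (ha : ∀ i : ℤ, 2 * a + i ≠ 0) (m : ℕ) :
    evenWeight a m m * (poch (a + 1) m * poch (a + 2 * m + 2) m) =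
      (-1) ^ m * (2 * m).factorial := by
  have key : ∀ d : ℕ, evenWeight a m d * (poch (a + 1) d * poch (a + 2 * m + 2) d *
      ∏ i ∈ Finset.range d, (a + 2 * m - i)) * d.factorial = (-1) ^ d * (2 * d).factorial *
        ((∏ i ∈ Finset.range d, ((m : ℂ) - i)) * poch (a + m + 1) d) := by
    intro d
    induction d with
    | zero => simp [evenWeight]
    | succ d ih =>
      have hw := evenWeight_succ ha m d
      rw [show 2 * (d + 1) = 2 * d + 1 + 1 by ring]
      simp only [Nat.factorial_succ, Finset.prod_range_succ, poch_succ, pow_succ]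
      push_cast
      linear_combination (poch (a + 1) d * poch (a + 2 * m + 2) d *
        (∏ i ∈ Finset.range d, (a + 2 * m - i)) * d.factorial * (d + 1)) * hw +
        (-2 * (2 * d + 1) * (m - d) * (a + m + 1 + d) * (d + 1)) * ih
  have h := key m
  have hp : ∏ i ∈ Finset.range m, (a + 2 * m - i) = poch (a + m + 1) m := by
    rw [poch, ← Finset.prod_range_reflect]
    refine Finset.prod_congr rfl fun i hi => ?_
    have := Finset.mem_range.1 hi
    rw [show m - 1 - i = m - (1 + i) by omega, Nat.cast_sub (by omega)]
    push_cast
    ring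
  have hf : ∏ i ∈ Finset.range m, ((i : ℂ) + 1) = m.factorial := by
    rw [← Finset.prod_range_add_one_eq_factorial]
    push_cast
    rfl
  have h0 : poch (a + m + 1) m ≠ 0 := poch_ne_zero (fun i => by
    simpa [add_assoc] using add_intCast_ne_zero ha (m + 1 + i)) m
  have h1 : (m.factorial : ℂ) ≠ 0 := by exact_mod_cast Nat.factorial_ne_zero m
  rw [prod_range_natCast_sub, hf, hp] at h
  apply mul_left_cancel₀ (mul_ne_zero h0 h1)
  linear_combination h

/-- A basis of polynomials adapted to the symmetry `z ↦ 1 - z`. -/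
noncomputable def rowPoly (k : ℕ) : Polynomial ℂ :=
  (if Even k then 1 else 2 * Polynomial.X - 1) * (Polynomial.X * (Polynomial.X - 1)) ^ (k / 2)

/-- The series by which a row is multiplied before its `j`-th coefficient is extracted. -/
noncomputable def colSeries (a : ℂ) (j : ℕ) : PowerSeries ℂ :=
  (if Even j then 1 else 2 - PowerSeries.X) * oneSubPow (a + (j / 2 : ℕ))

/-- The rows `y ^ i - (1 - y) ^ (-(2a+1) - i)`, preceded by the border row `1`. -/
noncomputable def borderedRow (a : ℂ) : ℕ → PowerSeries ℂ
  | 0 => 1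
  | i + 1 => rowMap a (Polynomial.X ^ i)

/-- The rows attached to `rowPoly`, preceded by the border row `1`. -/
noncomputable def reducedRow (a : ℂ) : ℕ → PowerSeries ℂ
  | 0 => 1
  | k + 1 => rowMap a (rowPoly k)

/-- The entries of the matrix of row operations. -/
noncomputable def rowOp : ℕ → ℕ → ℂ
  | 0, 0 => 1
  | 0, _ + 1 => 0
  | _ + 1, 0 => 0
  | k + 1, i + 1 => (rowPoly k).coeff i

/-- The entries of the matrix of column operations. -/
noncomputable def colOp (a : ℂ) (l j : ℕ) : ℂ :=
  if l ≤ j then PowerSeries.coeff (j - l) (colSeries a j) else 0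

/-- The matrix obtained from the bordered matrix by the row and column operations. -/
noncomputable def reducedMatrix (a : ℂ) (N : ℕ) : Matrix (Fin N) (Fin N) ℂ :=
  Matrix.of fun i j => PowerSeries.coeff j.1 (colSeries a j * reducedRow a i)

lemma natDegree_leadingCoeff_rowPoly (k : ℕ) :
    (rowPoly k).natDegree = k ∧ (rowPoly k).leadingCoeff = if Even k then 1 else 2 := by
  have hm : (Polynomial.X * (Polynomial.X - 1) : Polynomial ℂ).Monic := by
    simpa using Polynomial.monic_X.mul (Polynomial.monic_X_sub_C (1 : ℂ))
  have hd : (Polynomial.X * (Polynomial.X - 1) : Polynomial ℂ).natDegree = 2 := by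
    rw [← Polynomial.C_1, Polynomial.monic_X.natDegree_mul (Polynomial.monic_X_sub_C (1 : ℂ)),
      Polynomial.natDegree_X, Polynomial.natDegree_X_sub_C]
  have hmk := hm.pow (k / 2)
  have hdk := hm.natDegree_pow (k / 2)
  rw [hd] at hdk
  rw [rowPoly]
  split_ifs with h
  · rw [one_mul, hdk, hmk]
    exact ⟨Nat.div_two_mul_two_of_even h, rfl⟩
  · have hl : (2 * Polynomial.X - 1 : Polynomial ℂ) =
        Polynomial.C 2 * Polynomial.X + Polynomial.C (-1) := by
      simp [sub_eq_add_neg, ← map_ofNat Polynomial.C 2]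
    have h0 : (Polynomial.C 2 * Polynomial.X + Polynomial.C (-1) : Polynomial ℂ) ≠ 0 := by
      intro h0
      have := Polynomial.leadingCoeff_linear (R := ℂ) (a := 2) (b := -1) two_ne_zero
      rw [h0] at this
      simp at this
    rw [Polynomial.leadingCoeff_mul_monic hmk, hl, Polynomial.natDegree_mul h0 hmk.ne_zero,
      Polynomial.natDegree_linear two_ne_zero, Polynomial.leadingCoeff_linear two_ne_zero, hdk]
    refine ⟨?_, rfl⟩
    have := Nat.odd_iff.1 (Nat.not_even_iff_odd.1 h)
    omega

lemma coeff_rowPoly_self (k : ℕ) : (rowPoly k).coeff k = if Even k then 1 else 2 := by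
  obtain ⟨h1, h2⟩ := natDegree_leadingCoeff_rowPoly k
  rw [← h2, Polynomial.leadingCoeff, h1]

lemma coeff_rowPoly_of_lt {k i : ℕ} (h : k < i) : (rowPoly k).coeff i = 0 :=
  Polynomial.coeff_eq_zero_of_natDegree_lt ((natDegree_leadingCoeff_rowPoly k).1.trans_lt h)

lemma coeff_zero_colSeries (a : ℂ) (j : ℕ) :
    PowerSeries.coeff 0 (colSeries a j) = if Even j then 1 else 2 := by
  have h : PowerSeries.constantCoeff (oneSubPow (a + (j / 2 : ℕ))) = 1 := by
    rw [← PowerSeries.coeff_zero_eq_constantCoeff_apply, coeff_oneSubPow]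
    simp
  rw [colSeries, PowerSeries.coeff_zero_eq_constantCoeff_apply, map_mul, h]
  split_ifs <;> simp [map_ofNat]

lemma prod_range_even_one_two (m : ℕ) :
    ∏ k ∈ Finset.range (2 * m), (if Even k then (1 : ℂ) else 2) = 2 ^ m := by
  induction m with
  | zero => simp
  | succ m ih =>
    rw [show 2 * (m + 1) = 2 * m + 1 + 1 by ring, Finset.prod_range_succ, Finset.prod_range_succ,
      ih]
    simp [pow_succ]

lemma det_rowOp (m : ℕ) :
    (Matrix.of fun i l : Fin (2 * m + 2) => rowOp i l).det = 2 ^ m := by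
  rw [Matrix.det_of_isLowerTriangular]
  · simp only [Matrix.of_apply]
    rw [Fin.prod_univ_eq_prod_range (fun i => rowOp i i), Finset.prod_range_succ']
    simp only [rowOp, coeff_rowPoly_self, mul_one]
    rw [Finset.prod_range_succ, prod_range_even_one_two]
    simp
  · intro i l h
    have h : i.1 < l.1 := h
    rw [Matrix.of_apply]
    obtain ⟨i, hi⟩ := i
    obtain ⟨l, hl⟩ := l
    cases l with
    | zero => simp at h
    | succ l =>
      cases i with
      | zero => rfl
      | succ i => exact coeff_rowPoly_of_lt (by simpa using h)

lemma det_colOp (a : ℂ) (m : ℕ) :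
    (Matrix.of fun l j : Fin (2 * m + 2) => colOp a l j).det = 2 ^ (m + 1) := by
  rw [Matrix.det_of_isUpperTriangular]
  · simp only [Matrix.of_apply]
    rw [Fin.prod_univ_eq_prod_range (fun i => colOp a i i)]
    simp only [colOp, le_refl, if_true, Nat.sub_self, coeff_zero_colSeries]
    exact prod_range_even_one_two (m + 1)
  · intro l j h
    have h : j.1 < l.1 := h
    rw [Matrix.of_apply, colOp, if_neg (by omega)]

lemma sum_coeff_mul_colOp (a : ℂ) {N j : ℕ} (hj : j < N) (r : PowerSeries ℂ) :
    ∑ l : Fin N, PowerSeries.coeff l.1 r * colOp a l j =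
      PowerSeries.coeff j (colSeries a j * r) := by
  rw [mul_comm, PowerSeries.coeff_mul, Finset.Nat.sum_antidiagonal_eq_sum_range_succ_mk,
    Fin.sum_univ_eq_sum_range (fun l => PowerSeries.coeff l r * colOp a l j)]
  refine (Finset.sum_subset (Finset.range_mono hj) fun l _ hl => ?_).symm.trans ?_
  · rw [colOp, if_neg (by simpa using hl), mul_zero]
  · refine Finset.sum_congr rfl fun l hl => ?_
    rw [colOp, if_pos (by simpa [Nat.lt_succ_iff] using hl)]

lemma sum_rowOp_mul (a : ℂ) {N i : ℕ} (hi : i < N) (F : PowerSeries ℂ →ₗ[ℂ] ℂ) :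
    ∑ l : Fin N, rowOp i l * F (borderedRow a l) = F (reducedRow a i) := by
  obtain ⟨N, rfl⟩ := Nat.exists_eq_succ_of_ne_zero (Nat.ne_zero_of_lt hi)
  rw [Fin.sum_univ_eq_sum_range (fun l => rowOp i l * F (borderedRow a l)),
    Finset.sum_range_succ']
  cases i with
  | zero => simp [rowOp, borderedRow, reducedRow]
  | succ k =>
    simp only [rowOp, borderedRow, reducedRow, zero_mul, add_zero]
    have h := (rowPoly k).as_sum_range' N
      ((natDegree_leadingCoeff_rowPoly k).1.trans_lt (by omega))
    conv_rhs => rw [h]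
    rw [map_sum, map_sum]
    refine Finset.sum_congr rfl fun i _ => ?_
    rw [← Polynomial.smul_X_eq_monomial, map_smul, map_smul, smul_eq_mul]

lemma reducedMatrix_eq_mul (a : ℂ) (N : ℕ) :
    reducedMatrix a N = (Matrix.of fun i l : Fin N => rowOp i l) *
      ((Matrix.of fun i j : Fin N => PowerSeries.coeff j.1 (borderedRow a i)) *
        (Matrix.of fun l j : Fin N => colOp a l j)) := by
  ext i j
  rw [Matrix.mul_apply]
  simp only [Matrix.mul_apply, Matrix.of_apply, sum_coeff_mul_colOp a j.2, reducedMatrix]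
  exact (sum_rowOp_mul a i.2
    ((PowerSeries.coeff j.1).comp (LinearMap.mulLeft ℂ (colSeries a j)))).symm

lemma coeff_succ_rowMap_X_pow (a : ℂ) (i j : ℕ) :
    PowerSeries.coeff (j + 1) (rowMap a (Polynomial.X ^ i)) =
      -((if i = j + 1 then (-1 : ℂ) else 0) + gbinom (2 * a + i + (j + 1)) (j + 1)) := by
  rw [rowMap_apply, map_pow, map_pow, Polynomial.aeval_X, Polynomial.aeval_X, ← oneSubPow_nsmul,
    ← oneSubPow_add, map_sub, PowerSeries.coeff_X_pow, coeff_oneSubPow, ← gbinom_reflect]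
  rw [show ((j + 1 : ℕ) : ℂ) - 1 - (-(2 * a + 1) + i * -1) = 2 * a + i + (j + 1) by
    push_cast; ring]
  simp only [eq_comm (a := j + 1)]
  split_ifs <;> ring

lemma det_borderedRow (a : ℂ) (m : ℕ) :
    (Matrix.of fun i j : Fin (2 * m + 2) => PowerSeries.coeff j.1 (borderedRow a i)).det =
      -bdet (2 * a + 2) (2 * m + 1) 0 1 := by
  rw [Matrix.det_succ_row_zero, Fin.sum_univ_succ, Finset.sum_eq_zero, add_zero]
  · have h : (Matrix.of fun i j : Fin (2 * m + 2) =>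
        PowerSeries.coeff j.1 (borderedRow a i)).submatrix Fin.succ (Fin.succAbove 0) =
        -(Matrix.of fun i j : Fin (2 * m + 1) => (if 0 + i.1 = 1 + j.1 then (-1 : ℂ) else 0)
      + gbinom (2 * a + 2 + ((0 + i.1 : ℕ) : ℂ) + ((1 + j.1 : ℕ) : ℂ) - 2) (1 + j.1)) := by
      ext i j
      simp only [Matrix.submatrix_apply, Matrix.of_apply, Matrix.neg_apply, Fin.val_succ,
        Fin.succAbove_zero, borderedRow, coeff_succ_rowMap_X_pow, zero_add, add_comm 1 j.1]
      push_cast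
      ring_nf
    rw [h, Matrix.det_neg, bdet]
    simp [borderedRow, pow_succ, pow_mul]
  · intro j _
    simp [borderedRow, PowerSeries.coeff_one]

lemma det_reducedMatrix (a : ℂ) (m : ℕ) :
    (reducedMatrix a (2 * m + 2)).det =
      -(2 ^ m * 2 ^ (m + 1)) * bdet (2 * a + 2) (2 * m + 1) 0 1 := by
  rw [reducedMatrix_eq_mul, Matrix.det_mul, Matrix.det_mul, det_rowOp, det_borderedRow, det_colOp]
  ring

/-- The block of even rows and even columns of `reducedMatrix`. -/
noncomputable def evenBlock (a : ℂ) (m : ℕ) : Matrix (Fin (m + 1)) (Fin (m + 1)) ℂ :=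
  Matrix.of fun i j =>
    Fin.cases (gbinom (a + (j : ℕ)) (2 * j)) (fun k : Fin m => -2 * evenEntry a k j) i

/-- The block of odd rows and odd columns of `reducedMatrix`. -/
noncomputable def oddBlock (a : ℂ) (m : ℕ) : Matrix (Fin (m + 1)) (Fin (m + 1)) ℂ :=
  Matrix.of fun k j => -2 * oddEntry a k j

/-- The equivalence splitting indices according to parity. -/
noncomputable def parityEquiv (m : ℕ) : Fin (m + 1) ⊕ Fin (m + 1) ≃ Fin (2 * m + 2) :=
  Equiv.ofBijective
    (Sum.elim (fun j => ⟨2 * j, by omega⟩) (fun j => ⟨2 * j + 1, by omega⟩)) <| by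
    rw [Fintype.bijective_iff_injective_and_card]
    refine ⟨?_, by simp; ring⟩
    rintro (i | i) (j | j) h <;> simp [Fin.ext_iff] at h ⊢ <;> omega

lemma val_parityEquiv_inl (m : ℕ) (j : Fin (m + 1)) : (parityEquiv m (Sum.inl j)).1 = 2 * j := rfl

lemma val_parityEquiv_inr (m : ℕ) (j : Fin (m + 1)) :
    (parityEquiv m (Sum.inr j)).1 = 2 * j + 1 := rfl

lemma colSeries_two_mul (a : ℂ) (j : ℕ) : colSeries a (2 * j) = oneSubPow (a + j) := by
  simp [colSeries]

lemma colSeries_two_mul_add_one (a : ℂ) (j : ℕ) :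
    colSeries a (2 * j + 1) = (2 - PowerSeries.X) * oneSubPow (a + j) := by
  rw [colSeries, if_neg (by simp), show (2 * j + 1) / 2 = j by omega]

lemma reducedRow_two_mul_add_one (a : ℂ) (k : ℕ) :
    reducedRow a (2 * k + 1) = rowMap a ((Polynomial.X * (Polynomial.X - 1)) ^ k) := by
  simp [reducedRow, rowPoly]

lemma reducedRow_two_mul_add_two (a : ℂ) (k : ℕ) :
    reducedRow a (2 * (k + 1)) = rowMap a
      ((2 * Polynomial.X - 1) * (Polynomial.X * (Polynomial.X - 1)) ^ k) := by
  rw [show 2 * (k + 1) = 2 * k + 1 + 1 by ring, reducedRow, rowPoly, if_neg (by simp),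
    show (2 * k + 1) / 2 = k by omega]

lemma det_reducedMatrix_eq_mul (a : ℂ) (m : ℕ) :
    (reducedMatrix a (2 * m + 2)).det = (evenBlock a m).det * (oddBlock a m).det := by
  rw [← Matrix.det_submatrix_equiv_self (parityEquiv m),
    ← Matrix.fromBlocks_toBlocks ((reducedMatrix a (2 * m + 2)).submatrix _ _)]
  have h21 : ((reducedMatrix a (2 * m + 2)).submatrix (parityEquiv m) (parityEquiv m)).toBlocks₂₁ =
      0 := by
    ext k j
    simp only [Matrix.toBlocks₂₁, Matrix.of_apply, Matrix.submatrix_apply, reducedMatrix,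
      val_parityEquiv_inl, val_parityEquiv_inr, colSeries_two_mul, reducedRow_two_mul_add_one,
      coeff_even_rowMap_pow, Matrix.zero_apply]
  have h11 : ((reducedMatrix a (2 * m + 2)).submatrix (parityEquiv m) (parityEquiv m)).toBlocks₁₁ =
      evenBlock a m := by
    ext i j
    simp only [Matrix.toBlocks₁₁, Matrix.of_apply, Matrix.submatrix_apply, reducedMatrix,
      val_parityEquiv_inl, colSeries_two_mul, evenBlock]
    cases i using Fin.cases with
    | zero =>
      simp only [Fin.val_zero, mul_zero, reducedRow, mul_one, coeff_oneSubPow, Fin.cases_zero]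
      simp
    | succ k =>
      simp only [Fin.val_succ, reducedRow_two_mul_add_two, coeff_even_rowMap_mul_pow,
        Fin.cases_succ]
  have h22 : ((reducedMatrix a (2 * m + 2)).submatrix (parityEquiv m) (parityEquiv m)).toBlocks₂₂ =
      oddBlock a m := by
    ext k j
    simp only [Matrix.toBlocks₂₂, Matrix.of_apply, Matrix.submatrix_apply, reducedMatrix,
      val_parityEquiv_inr, colSeries_two_mul_add_one, reducedRow_two_mul_add_one,
      coeff_odd_rowMap_pow, oddBlock]
  rw [h21, h11, h22, Matrix.det_fromBlocks_zero₂₁]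

lemma evenWeight_of_lt (a : ℂ) {l j : ℕ} (h : l < j) : evenWeight a l j = 0 :=
  Finset.prod_eq_zero (Finset.mem_range.2 h) (by simp)

lemma oddWeight_of_lt (a : ℂ) {l j : ℕ} (h : l < j) : oddWeight a l j = 0 :=
  Finset.prod_eq_zero (Finset.mem_range.2 h) (by simp)

/-- Truncating a sum over `Fin N` outside of which the weights vanish. -/
lemma sum_fin_mul_eq_sum_range {w f : ℕ → ℂ} {l N : ℕ} (hw : ∀ j, l < j → w j = 0)
    (hl : l < N) : ∑ j : Fin N, f j * w j = ∑ j ∈ Finset.range (l + 1), w j * f j := by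
  rw [Fin.sum_univ_eq_sum_range (fun j => f j * w j)]
  simp only [mul_comm (f _)]
  refine (Finset.sum_subset (Finset.range_mono hl) fun j _ hj => ?_).symm
  rw [hw j (by simpa using hj), zero_mul]

lemma det_upper_weight {w : ℕ → ℕ → ℂ} (hw : ∀ l j, l < j → w l j = 0) (N : ℕ) :
    (Matrix.of fun j l : Fin N => w l j).det = ∏ l ∈ Finset.range N, w l l := by
  rw [Matrix.det_of_isUpperTriangular]
  · exact Fin.prod_univ_eq_prod_range (fun l => w l l) N
  · intro j l h
    exact hw _ _ h

lemma det_lower {s : ℕ → ℕ → ℂ} (hs : ∀ l k, k < l → s l k = 0) (N : ℕ) :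
    (Matrix.of fun k l : Fin N => s l k).det = ∏ l ∈ Finset.range N, s l l := by
  rw [Matrix.det_of_isLowerTriangular]
  · exact Fin.prod_univ_eq_prod_range (fun l => s l l) N
  · intro k l h
    exact hs _ _ h

lemma det_bordered_lower {r : ℕ → ℂ} {s : ℕ → ℕ → ℂ} (hs : ∀ l k, k < l → s l k = 0) (m : ℕ) :
    (Matrix.of fun i l : Fin (m + 1) => (Fin.cases (r l) (fun k : Fin m => s l k) i : ℂ)).det =
      (-1) ^ m * r m * ∏ k ∈ Finset.range m, s k k := by
  rw [Matrix.det_succ_column _ (Fin.last m), Fin.sum_univ_succ, Finset.sum_eq_zero, add_zero]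
  · rw [← det_lower hs]
    congr 2
    · simp
    · ext k l
      simp
  · intro k _
    simp [hs m k k.2]

lemma det_evenBlock_mul {a : ℂ} (ha : ∀ i : ℤ, 2 * a + i ≠ 0) (m : ℕ) :
    (evenBlock a m).det * ∏ l ∈ Finset.range (m + 1), evenWeight a l l =
      (-1) ^ m * borderSum a m * ∏ k ∈ Finset.range m, (-2 * evenSum a k k) := by
  rw [← det_upper_weight (fun l j => evenWeight_of_lt a), ← Matrix.det_mul,
    ← det_bordered_lower (r := borderSum a) (s := fun l k => -2 * evenSum a l k)
      (fun l k h => by rw [evenSum_eq_zero ha h, mul_zero])]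
  congr 1
  ext i l
  rw [Matrix.mul_apply]
  cases i using Fin.cases with
  | zero =>
    exact sum_fin_mul_eq_sum_range (f := fun j => gbinom (a + j) (2 * j))
      (fun j => evenWeight_of_lt a) l.2
  | succ k =>
    refine (sum_fin_mul_eq_sum_range (f := fun j => -2 * evenEntry a k j)
      (fun j => evenWeight_of_lt a) l.2).trans ?_
    simp only [Matrix.of_apply, Fin.cases_succ, evenSum, Finset.mul_sum]
    exact Finset.sum_congr rfl fun j _ => by ring

lemma det_oddBlock_mul {a : ℂ} (ha : ∀ i : ℤ, 2 * a + i ≠ 0) (m : ℕ) :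
    (oddBlock a m).det * ∏ l ∈ Finset.range (m + 1), oddWeight a l l =
      ∏ k ∈ Finset.range (m + 1), (-2 * oddSum a k k) := by
  rw [← det_upper_weight (fun l j => oddWeight_of_lt a), ← Matrix.det_mul,
    ← det_lower (s := fun l k => -2 * oddSum a l k)
      (fun l k h => by rw [oddSum_eq_zero ha h, mul_zero])]
  congr 1
  ext k l
  rw [Matrix.mul_apply]
  refine (sum_fin_mul_eq_sum_range (f := fun j => -2 * oddEntry a k j)
    (fun j => oddWeight_of_lt a) l.2).trans ?_
  simp only [Matrix.of_apply, oddSum, Finset.mul_sum]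
  exact Finset.sum_congr rfl fun j _ => by ring

lemma evenWeight_self_ne_zero {a : ℂ} (ha : ∀ i : ℤ, 2 * a + i ≠ 0) (m : ℕ) :
    evenWeight a m m ≠ 0 := by
  intro h
  have := evenWeight_self ha m
  rw [h, zero_mul] at this
  have h2 : ((2 * m).factorial : ℂ) ≠ 0 := by exact_mod_cast Nat.factorial_ne_zero _
  exact mul_ne_zero (pow_ne_zero _ (by norm_num)) h2 this.symm

lemma oddWeight_self_ne_zero {a : ℂ} (ha : ∀ i : ℤ, 2 * a + i ≠ 0) (m : ℕ) :
    oddWeight a m m ≠ 0 := by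
  refine Finset.prod_ne_zero_iff.2 fun i hi => ?_
  have hi := Finset.mem_range.1 hi
  have hZ := add_intCast_ne_zero ha
  have h1 : (2 * i + 3 : ℂ) ≠ 0 := by norm_cast
  have h2 : (m - i : ℂ) ≠ 0 := sub_ne_zero.2 (by norm_cast; omega)
  have h3 : a + m + 1 + i ≠ 0 := by simpa [add_assoc] using hZ (m + 1 + i)
  have h4 : a + 3 * i + 5 ≠ 0 := by simpa [add_assoc] using hZ (3 * i + 5)
  have h5 : a + i ≠ 0 := by simpa using hZ i
  have h6 : a + 2 * m - 1 - i ≠ 0 := by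
    simpa [add_assoc, sub_eq_add_neg] using hZ (2 * m - 1 - i)
  have h7 : a + 2 * m + 3 + i ≠ 0 := by simpa [add_assoc] using hZ (2 * m + 3 + i)
  have h8 : a + 3 * i + 2 ≠ 0 := by simpa [add_assoc] using hZ (3 * i + 2)
  simp [h1, h2, h3, h4, h5, h6, h7, h8]

lemma bdet_eq_prod {a : ℂ} (ha : ∀ i : ℤ, 2 * a + i ≠ 0) (m : ℕ) :
    bdet (2 * a + 2) (2 * m + 1) 0 1 =
      (-1) ^ m * (borderSum a m / evenWeight a m m) *
        (∏ k ∈ Finset.range m, evenSum a k k / evenWeight a k k) *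
        ∏ k ∈ Finset.range (m + 1), oddSum a k k / oddWeight a k k := by
  have hE := det_evenBlock_mul ha m
  have hO := det_oddBlock_mul ha m
  have hD := (det_reducedMatrix a m).symm.trans (det_reducedMatrix_eq_mul a m)
  have hw : ∏ l ∈ Finset.range m, evenWeight a l l ≠ 0 :=
    Finset.prod_ne_zero_iff.2 fun l _ => evenWeight_self_ne_zero ha l
  have hw' := evenWeight_self_ne_zero ha m
  have hv : ∏ l ∈ Finset.range (m + 1), oddWeight a l l ≠ 0 :=
    Finset.prod_ne_zero_iff.2 fun l _ => oddWeight_self_ne_zero ha l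
  generalize bdet (2 * a + 2) (2 * m + 1) 0 1 = b at *
  rw [Finset.prod_div_distrib, Finset.prod_div_distrib]
  rw [Finset.prod_range_succ, Finset.prod_mul_distrib, Finset.prod_const, Finset.card_range] at hE
  rw [Finset.prod_mul_distrib, Finset.prod_const, Finset.card_range] at hO
  generalize (∏ l ∈ Finset.range m, evenWeight a l l) = W at *
  generalize (∏ l ∈ Finset.range (m + 1), oddWeight a l l) = V at *
  rw [neg_pow 2 m] at hE
  rw [neg_pow 2 (m + 1)] at hO
  have hs : ((-1 : ℂ) ^ m) * (-1) ^ m = 1 := by rw [← mul_pow]; simp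
  have h2 : (2 : ℂ) ^ m * 2 ^ (m + 1) ≠ 0 :=
    mul_ne_zero (pow_ne_zero _ two_ne_zero) (pow_ne_zero _ two_ne_zero)
  field_simp
  apply mul_left_cancel₀ h2
  linear_combination (-(W * evenWeight a m m * V)) * hD - (oddBlock a m).det * V * hE
    - ((-1) ^ m * borderSum a m * ((-1) ^ m * 2 ^ m * ∏ k ∈ Finset.range m, evenSum a k k)) * hO +
    (2 : ℂ) ^ m * 2 ^ (m + 1) * (-1) ^ m * borderSum a m * (∏ k ∈ Finset.range m, evenSum a k k) *
      (∏ k ∈ Finset.range (m + 1), oddSum a k k) * hs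

lemma poch_add (x : ℂ) (p q : ℕ) : poch x (p + q) = poch x p * poch (x + p) q := by
  rw [poch, Finset.prod_range_add]
  simp [poch, add_assoc]

lemma poch_eq_div {x y : ℂ} {p q r : ℕ} (hx : ∀ n, poch x n ≠ 0) (hy : y = x + p)
    (hr : r = p + q) : poch y q = poch x r / poch x p := by
  rw [hr, poch_add, hy, mul_div_cancel_left₀ _ (hx p)]

lemma poch_two_mul (a : ℂ) (n : ℕ) :
    poch (2 * a) (2 * n) = 4 ^ n * poch a n * poch (a + 1 / 2) n := by
  induction n with
  | zero => simp
  | succ n ih =>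
    rw [show 2 * (n + 1) = 2 * n + 1 + 1 by ring, poch_succ, poch_succ, ih, poch_succ, poch_succ]
    push_cast
    ring

lemma poch_ne_zero_of_generic {a : ℂ} (ha : ∀ i : ℤ, 2 * a + i ≠ 0) (n : ℕ) : poch a n ≠ 0 :=
  poch_ne_zero (fun i => by simpa using add_intCast_ne_zero ha i) n

lemma poch_two_mul_ne_zero {a : ℂ} (ha : ∀ i : ℤ, 2 * a + i ≠ 0) (n : ℕ) : poch (2 * a) n ≠ 0 :=
  poch_ne_zero (fun i => by simpa using ha i) n

lemma poch_add_half_ne_zero {a : ℂ} (ha : ∀ i : ℤ, 2 * a + i ≠ 0) (n : ℕ) :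
    poch (a + 1 / 2) n ≠ 0 := by
  refine poch_ne_zero (fun i h => ha (1 + 2 * i) ?_) n
  push_cast
  linear_combination 2 * h

lemma factorial_two_mul_eq (m : ℕ) :
    ((2 * m).factorial : ℂ) = m.factorial * poch (m + 1) m := by
  have h (n : ℕ) : poch 1 n = n.factorial := by
    induction n with
    | zero => simp
    | succ n ih =>
      rw [poch_succ, ih, Nat.factorial_succ]
      push_cast
      ring
  rw [← h, ← h, two_mul, poch_add, add_comm (1 : ℂ)]

lemma poch_natCast_succ_ne_zero (p m : ℕ) : poch (p + 1) m ≠ 0 :=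
  poch_ne_zero (fun i => by norm_cast; omega) m

lemma borderSum_div {a : ℂ} (ha : ∀ i : ℤ, 2 * a + i ≠ 0) (m : ℕ) :
    borderSum a m / evenWeight a m m = (-1) ^ m * poch (2 * a) (3 * m + 2) * poch a (m + 1) ^ 2 /
      (a * poch (2 * a) (2 * m + 2) * poch a (2 * m + 1) * m.factorial) := by
  have hA := poch_ne_zero_of_generic ha
  have hH := poch_two_mul_ne_zero ha
  have hb := borderSum_eq ha m
  have hw := evenWeight_self ha m
  rw [show poch (a + m + 1) m = poch a (2 * m + 1) / poch a (m + 1) from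
      poch_eq_div hA (by push_cast; ring) (by ring),
    show poch (a + 2 * m + 2) m = poch a (3 * m + 2) / poch a (2 * m + 2) from
      poch_eq_div hA (by push_cast; ring) (by ring),
    show poch (2 * a + 2 * m + 2) m = poch (2 * a) (3 * m + 2) / poch (2 * a) (2 * m + 2) from
      poch_eq_div hH (by push_cast; ring) (by ring)]
    at hb
  rw [show poch (a + 1) m = poch a (m + 1) / poch a 1 from
      poch_eq_div hA (by push_cast; ring) (by ring),
    show poch (a + 2 * m + 2) m = poch a (3 * m + 2) / poch a (2 * m + 2) from
      poch_eq_div hA (by push_cast; ring) (by ring),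
    factorial_two_mul_eq, poch_succ a 0, poch_zero] at hw
  have h0 : a ≠ 0 := by simpa using add_intCast_ne_zero ha 0
  have h1 := hA (m + 1)
  have h2 := hA (2 * m + 1)
  have h3 := hA (2 * m + 2)
  have h4 := hA (3 * m + 2)
  have h5 := hH (2 * m + 2)
  have h6 : (m.factorial : ℂ) ≠ 0 := by exact_mod_cast Nat.factorial_ne_zero _
  have h7 := poch_natCast_succ_ne_zero m m
  have h8 := evenWeight_self_ne_zero ha m
  have hs : ((-1 : ℂ) ^ m) * (-1) ^ m = 1 := by rw [← mul_pow]; simp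
  generalize poch a (m + 1) = A1 at *
  generalize poch a (2 * m + 1) = A2 at *
  generalize poch a (2 * m + 2) = A3 at *
  generalize poch a (3 * m + 2) = A4 at *
  generalize poch (2 * a) (2 * m + 2) = H1 at *
  generalize poch (2 * a) (3 * m + 2) = H2 at *
  generalize poch ((m : ℂ) + 1) m = P at *
  generalize evenWeight a m m = w at *
  generalize (m.factorial : ℂ) = f at *
  simp only [Nat.cast_zero, add_zero, one_mul] at hw
  field_simp at hb hw ⊢
  apply mul_left_cancel₀ h4
  linear_combination (a * f) * hb - (-1) ^ m * A1 * H2 * hw - A1 * A3 * P * H2 * a * f * hs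

lemma evenSum_div {a : ℂ} (ha : ∀ i : ℤ, 2 * a + i ≠ 0) (m : ℕ) :
    evenSum a m m / evenWeight a m m =
      poch a (3 * m + 2) * poch a (m + 1) * poch (2 * a) (3 * m + 2) /
        (poch a (2 * m + 2) * poch a (2 * m + 1) * poch (2 * a) (2 * m + 2) * poch (m + 1) m) := by
  have hA := poch_ne_zero_of_generic ha
  have hH := poch_two_mul_ne_zero ha
  have hD := poch_add_half_ne_zero ha
  have hb := evenSum_self ha m
  have e1 := poch_two_mul a (m + 1)
  have e2 := poch_two_mul a (2 * m + 1)
  rw [show 2 * (m + 1) = 2 * m + 2 by ring] at e1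
  rw [show 2 * (2 * m + 1) = 4 * m + 2 by ring] at e2
  rw [show poch (a + m + 3 / 2) m = poch (a + 1 / 2) (2 * m + 1) / poch (a + 1 / 2) (m + 1) from
      poch_eq_div hD (by push_cast; ring) (by ring),
    show poch (a + 2 * m + 2) m = poch a (3 * m + 2) / poch a (2 * m + 2) from
      poch_eq_div hA (by push_cast; ring) (by ring),
    show poch (2 * a + 3 * m + 2) m = poch (2 * a) (4 * m + 2) / poch (2 * a) (3 * m + 2) from
      poch_eq_div hH (by push_cast; ring) (by ring),
    e2] at hb
  rw [e1]
  have h1 := hA (m + 1)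
  have h2 := hA (2 * m + 1)
  have h3 := hA (2 * m + 2)
  have h4 := hD (m + 1)
  have h5 := hD (2 * m + 1)
  have h6 := hH (3 * m + 2)
  have h7 := poch_natCast_succ_ne_zero m m
  have h8 := evenWeight_self_ne_zero ha m
  generalize poch a (m + 1) = A1 at *
  generalize poch a (2 * m + 1) = A2 at *
  generalize poch a (2 * m + 2) = A3 at *
  generalize poch a (3 * m + 2) = A4 at *
  generalize poch (a + 1 / 2) (m + 1) = D1 at *
  generalize poch (a + 1 / 2) (2 * m + 1) = D2 at *
  generalize poch (2 * a) (3 * m + 2) = H2 at *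
  generalize poch ((m : ℂ) + 1) m = P at *
  generalize evenWeight a m m = w at *
  generalize evenSum a m m = s at *
  have h9 : (4 : ℂ) ^ m ≠ 0 := pow_ne_zero _ (by norm_num)
  rw [show (4 : ℂ) ^ (2 * m + 1) = 4 ^ m * 4 ^ m * 4 by ring] at hb
  rw [show (4 : ℂ) ^ (m + 1) = 4 ^ m * 4 by ring]
  generalize (4 : ℂ) ^ m = f at *
  field_simp at hb ⊢
  linear_combination hb

lemma oddSum_div {a : ℂ} (ha : ∀ i : ℤ, 2 * a + i ≠ 0) (m : ℕ) :
    oddSum a m m / oddWeight a m m =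
      poch a (3 * m + 2) * poch a m * poch (2 * a) (3 * m + 2) /
        (poch a (2 * m + 2) * poch a (2 * m + 1) * poch (2 * a) (2 * m) *
          poch (m + 2) (m + 1)) := by
  have hA := poch_ne_zero_of_generic ha
  have hH := poch_two_mul_ne_zero ha
  have hD := poch_add_half_ne_zero ha
  have hb := oddSum_self ha m
  have e1 := poch_two_mul a m
  have e2 := poch_two_mul a (2 * m + 1)
  rw [show 2 * (2 * m + 1) = 4 * m + 2 by ring] at e2
  rw [show poch (a + m + 1 / 2) (m + 1) = poch (a + 1 / 2) (2 * m + 1) / poch (a + 1 / 2) m from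
      poch_eq_div hD (by ring) (by ring),
    show poch (a + 2 * m + 2) (m + 1) = poch a (3 * m + 2 + 1) / poch a (2 * m + 2) from
      poch_eq_div hA (by push_cast; ring) (by ring),
    show poch (2 * a + 3 * m + 1) (m + 1) = poch (2 * a) (4 * m + 2) / poch (2 * a) (3 * m + 1) from
      poch_eq_div hH (by push_cast; ring) (by ring),
    e2, poch_succ a (3 * m + 2)] at hb
  rw [e1, poch_succ (2 * a) (3 * m + 1)]
  have h0 : a + 3 * m + 2 ≠ 0 := by simpa [add_assoc] using add_intCast_ne_zero ha (3 * m + 2)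
  have h1 := hA m
  have h2 := hA (2 * m + 1)
  have h3 := hA (2 * m + 2)
  have h4 := hD m
  have h5 := hD (2 * m + 1)
  have h6 := hH (3 * m + 1)
  have h7 : poch ((m : ℂ) + 2) (m + 1) ≠ 0 := by
    simpa [add_assoc, one_add_one_eq_two] using poch_natCast_succ_ne_zero (m + 1) (m + 1)
  have h8 := oddWeight_self_ne_zero ha m
  generalize poch a m = A1 at *
  generalize poch a (2 * m + 1) = A2 at *
  generalize poch a (2 * m + 2) = A3 at *
  generalize poch a (3 * m + 2) = A4 at *
  generalize poch (a + 1 / 2) m = D1 at *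
  generalize poch (a + 1 / 2) (2 * m + 1) = D2 at *
  generalize poch (2 * a) (3 * m + 1) = H2 at *
  generalize poch ((m : ℂ) + 2) (m + 1) = P at *
  generalize oddWeight a m m = w at *
  generalize oddSum a m m = s at *
  have h9 : (4 : ℂ) ^ m ≠ 0 := pow_ne_zero _ (by norm_num)
  rw [show (4 : ℂ) ^ (2 * m + 1) = 4 ^ m * 4 ^ m * 4 by ring,
    show (4 : ℂ) ^ (m + 1) = 4 ^ m * 4 by ring] at hb
  push_cast at hb ⊢
  rw [← add_assoc a, ← add_assoc (2 * a)] at *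
  generalize hL : a + 3 * (m : ℂ) + 2 = L at *
  generalize hM : 2 * a + 3 * (m : ℂ) + 1 = M at *
  generalize (4 : ℂ) ^ m = f at *
  field_simp at hb ⊢
  linear_combination hb

lemma Q1_eq {a : ℂ} (ha : ∀ i : ℤ, 2 * a + i ≠ 0) (m : ℕ) :
    Q1 (2 * a + 2) (m + 1) =
      2 * poch a (3 * m + 5) * poch (2 * a) (3 * m + 5) * poch a (m + 2) /
        (poch (m + 1 + 2) (m + 2) * poch a (2 * m + 3) * poch (2 * a) (2 * m + 3) *
          poch a (2 * m + 4)) := by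
  have hA := poch_ne_zero_of_generic ha
  have hH := poch_two_mul_ne_zero ha
  rw [Q1, show m + 1 + 1 = m + 2 by ring,
    show poch ((2 * a + 2) / 2 + 2 * (m + 1 : ℕ)) (m + 2) =
      poch a (3 * m + 5) / poch a (2 * m + 3) from
      poch_eq_div hA (by push_cast; ring) (by ring),
    show poch (2 * a + 2 + 2 * (m + 1 : ℕ) - 1) (m + 2) =
      poch (2 * a) (3 * m + 5) / poch (2 * a) (2 * m + 3) from
      poch_eq_div hH (by push_cast; ring) (by ring),
    show poch ((2 * a + 2) / 2 + (m + 1 : ℕ)) (m + 2) =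
      poch a (2 * m + 4) / poch a (m + 2) from
      poch_eq_div hA (by push_cast; ring) (by ring)]
  have h1 := hA (2 * m + 4)
  have h2 := hA (m + 2)
  push_cast
  field_simp

lemma Q2_eq {a : ℂ} (ha : ∀ i : ℤ, 2 * a + i ≠ 0) (m : ℕ) :
    Q2 (2 * a + 2) (m + 1) =
      2 * (a + m + 1) * poch a (3 * m + 2) * poch (2 * a) (3 * m + 5) * poch a (m + 3) /
        ((m + 1) * poch (m + 1) m * poch a (2 * m + 2) * poch (2 * a) (2 * m + 5) *
          poch a (2 * m + 3)) := by
  have hA := poch_ne_zero_of_generic ha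
  have hH := poch_two_mul_ne_zero ha
  rw [Q2, Nat.add_sub_cancel,
    show poch ((2 * a + 2) / 2 + 2 * (m + 1 : ℕ) - 1) m =
      poch a (3 * m + 2) / poch a (2 * m + 2) from
      poch_eq_div hA (by push_cast; ring) (by ring),
    show poch (2 * a + 2 + 2 * (m + 1 : ℕ) + 1) m =
      poch (2 * a) (3 * m + 5) / poch (2 * a) (2 * m + 5) from
      poch_eq_div hH (by push_cast; ring) (by ring),
    show poch ((2 * a + 2) / 2 + (m + 1 : ℕ) + 1) m =
      poch a (2 * m + 3) / poch a (m + 3) from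
      poch_eq_div hA (by push_cast; ring) (by ring)]
  have h1 := hA (2 * m + 3)
  have h2 := hA (m + 3)
  push_cast
  field_simp
  ring

lemma neg_ratio_eq_Q1_mul_Q2 {a : ℂ} (ha : ∀ i : ℤ, 2 * a + i ≠ 0) (m : ℕ) :
    -(borderSum a (m + 1) / evenWeight a (m + 1) (m + 1)) * (evenSum a m m / evenWeight a m m) *
        (oddSum a (m + 1) (m + 1) / oddWeight a (m + 1) (m + 1)) =
      borderSum a m / evenWeight a m m *
        (Q1 (2 * a + 2) (m + 1) * Q2 (2 * a + 2) (m + 1)) := by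
  have hA := poch_ne_zero_of_generic ha
  have hH := poch_two_mul_ne_zero ha
  rw [borderSum_div ha, borderSum_div ha, evenSum_div ha, oddSum_div ha, Q1_eq ha, Q2_eq ha,
    Nat.factorial_succ]
  rw [show 3 * (m + 1) + 2 = 3 * m + 5 by ring, show 2 * (m + 1) + 2 = 2 * m + 4 by ring,
    show 2 * (m + 1) + 1 = 2 * m + 3 by ring, show 2 * (m + 1) = 2 * m + 2 by ring,
    show m + 1 + 1 = m + 2 by ring,
    show poch a (m + 3) = poch a (m + 2) * (a + (m + 2)) by simp [poch_succ],
    show poch (2 * a) (2 * m + 5) = poch (2 * a) (2 * m + 4) * (2 * (a + m + 2)) by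
      rw [poch_succ]; push_cast; ring,
    show poch (2 * a) (2 * m + 3) = poch (2 * a) (2 * m + 2) * (2 * (a + m + 1)) by
      rw [poch_succ]; push_cast; ring]
  push_cast
  have g0 : a ≠ 0 := by simpa using add_intCast_ne_zero ha 0
  have g1 : a + m + 1 ≠ 0 := by simpa [add_assoc] using add_intCast_ne_zero ha (m + 1)
  have g2 : a + m + 2 ≠ 0 := by simpa [add_assoc] using add_intCast_ne_zero ha (m + 2)
  have g3 : (m + 1 : ℂ) ≠ 0 := by norm_cast
  have g4 : (m.factorial : ℂ) ≠ 0 := by exact_mod_cast Nat.factorial_ne_zero _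
  have h0 := hA (m + 1)
  have h1 := hA (2 * m + 1)
  have h2 := hA (2 * m + 2)
  have h3 := hA (2 * m + 3)
  have h4 := hA (2 * m + 4)
  have h5 := hH (2 * m + 2)
  have h6 := hH (2 * m + 4)
  have h7 := poch_natCast_succ_ne_zero m m
  have h8 : poch ((m : ℂ) + 1 + 2) (m + 2) ≠ 0 := by
    have := poch_natCast_succ_ne_zero (m + 2) (m + 2)
    push_cast at this
    rwa [show (m : ℂ) + 2 + 1 = m + 1 + 2 by ring] at this
  generalize poch a (m + 1) = A0 at *
  generalize poch a (2 * m + 1) = A1 at *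
  generalize poch a (2 * m + 2) = A2 at *
  generalize poch a (2 * m + 3) = A3 at *
  generalize poch a (2 * m + 4) = A4 at *
  generalize poch (2 * a) (2 * m + 2) = H1 at *
  generalize poch (2 * a) (2 * m + 4) = H2 at *
  generalize poch ((m : ℂ) + 1) m = P at *
  generalize poch ((m : ℂ) + 1 + 2) (m + 2) = P' at *
  generalize poch a (m + 2) = B at *
  generalize poch a (3 * m + 2) = C at *
  generalize poch a (3 * m + 5) = C' at *
  generalize poch (2 * a) (3 * m + 2) = G at *
  generalize poch (2 * a) (3 * m + 5) = G' at *
  rw [pow_succ]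
  field_simp
  ring

lemma bdet_generic {a : ℂ} (ha : ∀ i : ℤ, 2 * a + i ≠ 0) (m : ℕ) :
    bdet (2 * a + 2) (2 * m + 1) 0 1 =
      (2 * a + 1) * ∏ k ∈ Finset.range m, (Q1 (2 * a + 2) (k + 1) * Q2 (2 * a + 2) (k + 1)) := by
  induction m with
  | zero =>
    simp [bdet, gbinom]
    ring
  | succ m ih =>
    rw [Finset.prod_range_succ, ← mul_assoc, ← ih, bdet_eq_prod ha, bdet_eq_prod ha,
      Finset.prod_range_succ _ m, Finset.prod_range_succ _ (m + 1), pow_succ]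
    linear_combination (-1) ^ m * (∏ k ∈ Finset.range m, evenSum a k k / evenWeight a k k) *
      (∏ k ∈ Finset.range (m + 1), oddSum a k k / oddWeight a k k) * neg_ratio_eq_Q1_mul_Q2 ha m

lemma continuous_poch (k : ℕ) : Continuous fun x => poch x k := by
  unfold poch
  fun_prop

lemma continuous_gbinom (k : ℕ) : Continuous fun x => gbinom x k := by
  unfold gbinom
  fun_prop

lemma continuous_bdet (n I J : ℕ) : Continuous fun μ => bdet μ n I J := by
  refine Continuous.matrix_det (continuous_matrix fun i j => ?_)
  exact continuous_const.add ((continuous_gbinom _).comp (by fun_prop))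

lemma continuousAt_Q1 {μ : ℂ} {k : ℕ}
    (h : poch ((k : ℂ) + 2) (k + 1) * poch (μ / 2 + k) (k + 1) ≠ 0) :
    ContinuousAt (fun μ => Q1 μ k) μ := by
  have hp := continuous_poch
  refine ContinuousAt.div (Continuous.continuousAt ?_) (Continuous.continuousAt ?_) h <;> fun_prop

lemma continuousAt_Q2 {μ : ℂ} {k : ℕ}
    (h : (k : ℂ) * poch (k : ℂ) (k - 1) * poch (μ / 2 + k + 1) (k - 1) ≠ 0) :
    ContinuousAt (fun μ => Q2 μ k) μ := by
  have hp := continuous_poch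
  refine ContinuousAt.div (Continuous.continuousAt ?_) (Continuous.continuousAt ?_) h <;> fun_prop

lemma dense_generic : Dense {μ : ℂ | ∀ i : ℤ, 2 * ((μ - 2) / 2) + i ≠ 0} := by
  have h : {μ : ℂ | ∀ i : ℤ, 2 * ((μ - 2) / 2) + i ≠ 0} =
      (Set.range fun i : ℤ => (2 - i : ℂ))ᶜ := by
    ext μ
    simp only [Set.mem_ofPred_eq, Set.mem_compl_iff, Set.mem_range, not_exists]
    refine forall_congr' fun i => not_congr ⟨fun h => ?_, fun h => ?_⟩ <;> linear_combination -h
  rw [h]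
  exact (Set.countable_range _).dense_compl ℂ

/-- Theorem (b01), odd case: the determinant `b_n(0,1,μ)`, whenever all
denominators occurring in `Q1`, `Q2` are nonzero. -/
theorem b01_odd (μ : ℂ) (n : ℕ) (hn : 0 < n) (hno : Odd n)
    (h1 : ∀ k ∈ Finset.Icc 1 ((n - 1) / 2),
      poch ((k : ℂ) + 2) (k + 1) * poch (μ / 2 + k) (k + 1) ≠ 0)
    (h2 : ∀ k ∈ Finset.Icc 1 ((n - 1) / 2),
      (k : ℂ) * poch (k : ℂ) (k - 1) * poch (μ / 2 + k + 1) (k - 1) ≠ 0) :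
    bdet μ n 0 1
      = (μ - 1) * ∏ k ∈ Finset.Icc 1 ((n - 1) / 2), Q1 μ k * Q2 μ k := by
  obtain ⟨m, rfl⟩ := hno
  rw [show (2 * m + 1 - 1) / 2 = m by omega] at *
  have hR : ContinuousAt (fun μ => (μ - 1) * ∏ k ∈ Finset.Icc 1 m, Q1 μ k * Q2 μ k) μ := by
    refine ContinuousAt.mul (by fun_prop) (tendsto_finsetProd _ fun k hk => ?_)
    exact (continuousAt_Q1 (h1 k hk)).mul (continuousAt_Q2 (h2 k hk))
  refine tendsto_nhds_unique_of_frequently_eq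
    (continuous_bdet (2 * m + 1) 0 1).continuousAt hR ?_
  refine (mem_closure_iff_frequently.1 (dense_generic μ)).mono fun ν hν => ?_
  have h := bdet_generic hν m
  rw [show 2 * ((ν - 2) / 2) + 2 = ν by ring, show 2 * ((ν - 2) / 2) + 1 = ν - 1 by ring] at h
  rw [h, Finset.range_eq_Ico, Finset.prod_Ico_add' (fun k => Q1 ν k * Q2 ν k) 0 m 1]
  rfl
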